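/- arXiv:math/9911214 — 2 statements merged into one kernel-verified Lean document; each statement's English description precedes it below -/
import Mathlib

section
/- Let K ⊆ J ⊆ ∘I with J nonempty, and let u ∈ ∘W^K_J. (1) If C is a convex set in uΔ_{K+}, then C ⊔ Δ^K_J(u, −) and C ⊔ Δ^K_J(u, +) are convex sets in Δ_{J+}. (2) If C is a biconvex set in uΔ_{K+}, then C ⊔ Δ^K_J(u, −) and C ⊔ Δ^K_J(u, +) are biconvex sets in Δ_{J+}. -/
open scoped Pointwise

section

variable {ι V : Type*} [Fintype ι] [Nonempty ι] [AddCommGroup V] [Module ℝ V]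

/-- The length of `w` with respect to a generating set `S` of a group. -/
noncomputable def lenG {G : Type*} [Group G] (S : Set G) (w : G) : ℕ :=
  sInf {n | ∃ l : List G, (∀ x ∈ l, x ∈ S) ∧ l.length = n ∧ l.prod = w}

/-- `v` is a nonnegative linear combination of the simple roots `α` of `∘Δ`. -/
def PosoComb (α : ι → V) (v : V) : Prop :=
  ∃ c : ι → ℝ, (∀ i, 0 ≤ c i) ∧ v = ∑ i, c i • α i

/-- The parabolic subgroup `∘W_J = ⟨s_j | j ∈ J⟩` of the finite Weyl group, realized
inside the group of linear automorphisms of `𝔥* = V`. -/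
def WoJ (α : ι → V) (s : V → V ≃ₗ[ℝ] V) (J : Set ι) : Subgroup (V ≃ₗ[ℝ] V) :=
  Subgroup.closure ((fun j => s (α j)) '' J)

/-- `∘Δ_J = ∘W_J(∘Π_J)` (so `∘Δ_∅ = ∅`). -/
def DeloJ (α : ι → V) (s : V → V ≃ₗ[ℝ] V) (J : Set ι) : Set V :=
  {v | ∃ g ∈ WoJ α s J, ∃ j ∈ J, v = g (α j)}

/-- `∘Δ`, the root system of the underlying finite-dimensional simple Lie algebra. -/
def Delo (α : ι → V) (s : V → V ≃ₗ[ℝ] V) : Set V := DeloJ α s Set.univ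

/-- `∘Δ^K_{J+} = (∘Δ_J ∖ ∘Δ_K) ∩ ∘Δ₊`. -/
def DeloKJpos (α : ι → V) (s : V → V ≃ₗ[ℝ] V) (J K : Set ι) : Set V :=
  (DeloJ α s J \ DeloJ α s K) ∩ {v | PosoComb α v}

/-- `∘Δ^K_{J−} = (∘Δ_J ∖ ∘Δ_K) ∩ ∘Δ₋`. -/
def DeloKJneg (α : ι → V) (s : V → V ≃ₗ[ℝ] V) (J K : Set ι) : Set V :=
  (DeloJ α s J \ DeloJ α s K) ∩ {v | PosoComb α (-v)}

/-- The set `∘W^K_J` of minimal-length representatives of the right cosets `∘W_J/∘W_K`. -/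
def MinReps (α : ι → V) (s : V → V ≃ₗ[ℝ] V) (J K : Set ι) : Set (V ≃ₗ[ℝ] V) :=
  {w | w ∈ WoJ α s J ∧ ∀ v ∈ WoJ α s K,
    lenG (Set.range fun i => s (α i)) w ≤ lenG (Set.range fun i => s (α i)) (w * v)}

/-- The affine simple roots `Π = {α₀ = δ − θ} ∪ ∘Π`, indexed by `Option ι`. -/
def alHat (α : ι → V) (δ θ : V) : Option ι → V := fun o => o.elim (δ - θ) α

/-- `v` is a nonnegative linear combination of the affine simple roots. -/
def PosComb (α : ι → V) (δ θ : V) (v : V) : Prop :=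
  ∃ c : Option ι → ℝ, (∀ o, 0 ≤ c o) ∧ v = ∑ o, c o • alHat α δ θ o

/-- The real roots `Δ^re = {mδ + ε | m ∈ ℤ, ε ∈ ∘Δ}`. -/
def DelRe (α : ι → V) (δ : V) (s : V → V ≃ₗ[ℝ] V) : Set V :=
  {v | ∃ m : ℤ, ∃ ε ∈ Delo α s, v = m • δ + ε}

/-- The imaginary roots `Δ^im = {mδ | m ∈ ℤ ∖ {0}}`. -/
def DelIm (δ : V) : Set V := {v | ∃ m : ℤ, m ≠ 0 ∧ v = m • δ}

/-- The affine root system `Δ = Δ^re ∪ Δ^im`. -/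
def Del (α : ι → V) (δ : V) (s : V → V ≃ₗ[ℝ] V) : Set V := DelRe α δ s ∪ DelIm δ

/-- The positive roots `Δ₊` (relative to `Π`). -/
def DelPos (α : ι → V) (δ θ : V) (s : V → V ≃ₗ[ℝ] V) : Set V :=
  {v ∈ Del α δ s | PosComb α δ θ v}

/-- The negative roots `Δ₋ = −Δ₊`. -/
def DelNeg (α : ι → V) (δ θ : V) (s : V → V ≃ₗ[ℝ] V) : Set V :=
  {v | -v ∈ DelPos α δ θ s}

/-- `Δ^re₊ = Δ^re ∩ Δ₊`. -/
def DelRePos (α : ι → V) (δ θ : V) (s : V → V ≃ₗ[ℝ] V) : Set V :=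
  DelRe α δ s ∩ DelPos α δ θ s

/-- `Δ^im₊ = {mδ | m ≥ 1}`. -/
def DelImPos (δ : V) : Set V := {v | ∃ m : ℕ, 0 < m ∧ v = (m : ℤ) • δ}

/-- `⟨ε⟩ = {mδ + ε | m ∈ ℤ≥0} ∩ Δ^re₊`. -/
def brkt (α : ι → V) (δ θ : V) (s : V → V ≃ₗ[ℝ] V) (ε : V) : Set V :=
  {v | ∃ m : ℕ, v = (m : ℤ) • δ + ε} ∩ DelRePos α δ θ s

/-- `⟨P⟩ = ⋃_{ε ∈ P} ⟨ε⟩`. -/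
def brSet (α : ι → V) (δ θ : V) (s : V → V ≃ₗ[ℝ] V) (P : Set V) : Set V :=
  ⋃ ε ∈ P, brkt α δ θ s ε

/-- `Δ^re_J = {mδ + ε | m ∈ ℤ, ε ∈ ∘Δ_J}`. -/
def DelReJ (α : ι → V) (δ : V) (s : V → V ≃ₗ[ℝ] V) (J : Set ι) : Set V :=
  {v | ∃ m : ℤ, ∃ ε ∈ DeloJ α s J, v = m • δ + ε}

/-- `Δ_J = Δ^re_J ∪ Δ^im`. -/
def DelJ (α : ι → V) (δ : V) (s : V → V ≃ₗ[ℝ] V) (J : Set ι) : Set V :=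
  DelReJ α δ s J ∪ DelIm δ

/-- `Δ_{J+} = Δ_J ∩ Δ₊`. -/
def DelJPos (α : ι → V) (δ θ : V) (s : V → V ≃ₗ[ℝ] V) (J : Set ι) : Set V :=
  DelJ α δ s J ∩ DelPos α δ θ s

/-- `Δ_{J+} = ⟨∘Δ_J⟩ ∪ Δ^im₊` (the description used from Section 5 onwards). -/
def DelJPosB (α : ι → V) (δ θ : V) (s : V → V ≃ₗ[ℝ] V) (J : Set ι) : Set V :=
  brSet α δ θ s (DeloJ α s J) ∪ DelImPos δ

/-- The set of highest roots of the irreducible components of `∘Δ_J`, i.e. the maximal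
elements of `∘Δ_{J+}`: the positive roots `ε` of `∘Δ_J` such that no `ε + α_j` is a root. -/
def HighRoots (α : ι → V) (s : V → V ≃ₗ[ℝ] V) (J : Set ι) : Set V :=
  {ε ∈ DeloJ α s J | PosoComb α ε ∧ ∀ j ∈ J, ε + α j ∉ DeloJ α s J}

/-- `Π_J = ∘Π_J ⊔ {δ − θ_{J_c} | c}`. -/
def PiJ (α : ι → V) (δ : V) (s : V → V ≃ₗ[ℝ] V) (J : Set ι) : Set V :=
  (α '' J) ∪ (fun x => δ - x) '' HighRoots α s J

/-- `S_J = {s_α | α ∈ Π_J}`. -/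
def SJ (α : ι → V) (δ : V) (s : V → V ≃ₗ[ℝ] V) (J : Set ι) : Set (V ≃ₗ[ℝ] V) :=
  s '' PiJ α δ s J

/-- `W_J = ⟨S_J⟩` (so `W_∅ = {1}`). -/
def WJ (α : ι → V) (δ : V) (s : V → V ≃ₗ[ℝ] V) (J : Set ι) : Subgroup (V ≃ₗ[ℝ] V) :=
  Subgroup.closure (SJ α δ s J)

/-- `Φ_J(y) = {β ∈ Δ_{J+} | y⁻¹(β) < 0}`, with `Δ_{J+} = Δ_J ∩ Δ₊`. -/
def PhiJ (α : ι → V) (δ θ : V) (s : V → V ≃ₗ[ℝ] V) (J : Set ι) (y : V ≃ₗ[ℝ] V) : Set V :=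
  {β ∈ DelJPos α δ θ s J | y⁻¹ β ∈ DelNeg α δ θ s}

/-- `Φ_J(y) = {β ∈ Δ_{J+} | y⁻¹(β) < 0}`, with `Δ_{J+} = ⟨∘Δ_J⟩ ∪ Δ^im₊`. -/
def PhiJb (α : ι → V) (δ θ : V) (s : V → V ≃ₗ[ℝ] V) (J : Set ι) (y : V ≃ₗ[ℝ] V) : Set V :=
  {β ∈ DelJPosB α δ θ s J | y⁻¹ β ∈ DelNeg α δ θ s}

/-- `Δ^K_J(u, −) = ⟨u∘Δ^K_{J−}⟩`. -/
def DKJm (α : ι → V) (δ θ : V) (s : V → V ≃ₗ[ℝ] V) (J K : Set ι) (u : V ≃ₗ[ℝ] V) : Set V :=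
  brSet α δ θ s (⇑u '' DeloKJneg α s J K)

/-- `Δ^K_J(u, +) = ⟨u∘Δ^K_{J+}⟩`. -/
def DKJp (α : ι → V) (δ θ : V) (s : V → V ≃ₗ[ℝ] V) (J K : Set ι) (u : V ≃ₗ[ℝ] V) : Set V :=
  brSet α δ θ s (⇑u '' DeloKJpos α s J K)

/-- `B` is a convex set in `A`: `B ⊆ A` and `β, γ ∈ B`, `β + γ ∈ A` imply `β + γ ∈ B`. -/
def ConvexIn (A B : Set V) : Prop :=
  B ⊆ A ∧ ∀ x ∈ B, ∀ y ∈ B, x + y ∈ A → x + y ∈ B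

/-- `B` is a biconvex set in `A`: both `B` and `A ∖ B` are convex sets in `A`. -/
def BiconvexIn (A B : Set V) : Prop :=
  ConvexIn A B ∧ ConvexIn A (A \ B)

/-- `P ⊆ ∘Δ` is a closed set. -/
def ClosedIn (Δo P : Set V) : Prop :=
  ∀ ε ∈ P, ∀ η ∈ P, ε + η ∈ Δo → ε + η ∈ P

/-- The coroot `α_j^∨ = 2α_j/(α_j|α_j)`. -/
noncomputable def coroot (α : ι → V) (B : V →ₗ[ℝ] V →ₗ[ℝ] ℝ) (j : ι) : V :=
  (2 / B (α j) (α j)) • α j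

/-- The coroot lattice `∘Q^∨_J = ⊕_{j ∈ J} ℤ α_j^∨`. -/
def QJ (α : ι → V) (B : V →ₗ[ℝ] V →ₗ[ℝ] ℝ) (J : Set ι) : Set V :=
  {lam | ∃ c : ι → ℤ, (∀ j, j ∉ J → c j = 0) ∧ lam = ∑ j, c j • coroot α B j}

/-- `g` acts as the translation `t_λ`: `g(μ) = μ − (μ|λ)δ` for `μ` in the span of `Π`. -/
def IsTransl (α : ι → V) (δ θ : V) (B : V →ₗ[ℝ] V →ₗ[ℝ] ℝ) (lam : V)
    (g : V ≃ₗ[ℝ] V) : Prop :=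
  ∀ μ ∈ Submodule.span ℝ (Set.range (alHat α δ θ)), g μ = μ - B μ lam • δ

/-- The translation subgroup `T_J = {t_λ | λ ∈ ∘Q^∨_J}` of `W_J`. -/
def TJ (α : ι → V) (δ θ : V) (B : V →ₗ[ℝ] V →ₗ[ℝ] ℝ) (s : V → V ≃ₗ[ℝ] V)
    (J : Set ι) : Set (V ≃ₗ[ℝ] V) :=
  {g | g ∈ WJ α δ s J ∧ ∃ lam ∈ QJ α B J, IsTransl α δ θ B lam g}

/-- The hypotheses describing the root datum of an untwisted affine Kac–Moody Lie algebra
over `ℝ`: `α` are the simple roots of the underlying finite-dimensional simple Lie algebra,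
`δ` is the null root, `θ` the highest root of `∘Δ`, `B` the standard invariant bilinear form,
and `s a` the reflection in a (real) root `a`. -/
structure AffineSetup (α : ι → V) (δ θ : V) (B : V →ₗ[ℝ] V →ₗ[ℝ] ℝ)
    (s : V → V ≃ₗ[ℝ] V) : Prop where
  indep : LinearIndependent ℝ (alHat α δ θ)
  Bsymm : ∀ u v : V, B u v = B v u
  Bpos : ∀ v ∈ Delo α s, 0 < B v v
  refl_def : ∀ a : V, B a a ≠ 0 → ∀ v : V, s a v = v - (2 * B v a / B a a) • a
  delta_orth : ∀ i : ι, B δ (α i) = 0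
  delta_null : B δ δ = 0
  theta_high : θ ∈ HighRoots α s Set.univ
  cryst : ∀ i : ι, ∀ v ∈ Delo α s, ∃ m : ℤ, s (α i) v = v - m • α i
  base : ∀ v ∈ Delo α s, Xor' (PosoComb α v) (PosoComb α (-v))
  finite : (Delo α s).Finite
  reduced : ∀ v ∈ Delo α s, (2 : ℝ) • v ∉ Delo α s
  irred : ∀ A : Set ι, (∀ i ∈ A, ∀ j ∈ Aᶜ, s (α i) (α j) = α j) → A = ∅ ∨ A = Set.univ

set_option linter.unusedSectionVars false

/-- Dual coordinates relative to the simple roots, vanishing on `δ`. -/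
structure IsCoord (α : ι → V) (δ : V) (c : ι → V →ₗ[ℝ] ℝ) : Prop where
  one : ∀ i, c i (α i) = 1
  zero : ∀ i j, i ≠ j → c i (α j) = 0
  delta : ∀ i, c i δ = 0

theorem exists_coord {α : ι → V} {δ θ : V} {B : V →ₗ[ℝ] V →ₗ[ℝ] ℝ} {s : V → V ≃ₗ[ℝ] V}
    (h : AffineSetup α δ θ B s) :
    ∃ (c : ι → V →ₗ[ℝ] ℝ) (d : V →ₗ[ℝ] ℝ), IsCoord α δ c ∧ d δ = 1 ∧ ∀ i, d (α i) = 0 := by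
  classical
  obtain ⟨-, ⟨t, -, ht⟩, -⟩ := h.theta_high
  have hind := h.indep
  rw [linearIndependent_iff_injective_fintypeLinearCombination] at hind
  obtain ⟨g, hg⟩ := LinearMap.exists_leftInverse_of_injective _ (LinearMap.ker_eq_bot.2 hind)
  have hg' : ∀ o, g (alHat α δ θ o) = Pi.single o 1 := by
    intro o
    have := LinearMap.congr_fun hg (Pi.single o 1)
    simpa [Fintype.linearCombination_apply_single] using this
  have hα : ∀ i, g (α i) = Pi.single (some i) 1 := fun i => hg' (some i)
  have hδ : g (δ - θ) = Pi.single none 1 := hg' none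
  let d : V →ₗ[ℝ] ℝ := (LinearMap.proj none).comp g
  let c' : ι → V →ₗ[ℝ] ℝ := fun i => (LinearMap.proj (some i)).comp g
  have hd : ∀ i, d (α i) = 0 := by intro i; simp [d, hα]
  have hdθ : d θ = 0 := by rw [ht]; simp [hd]
  have hdδ : d δ = 1 := by
    have : d (δ - θ) = 1 := by simp only [d, LinearMap.comp_apply, hδ]; simp
    rw [map_sub, hdθ] at this; linarith
  have hcδ : ∀ i, c' i δ = c' i θ := by
    intro i
    have : c' i (δ - θ) = 0 := by simp only [c', LinearMap.comp_apply, hδ]; simp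
    rw [map_sub] at this; linarith
  refine ⟨fun i => c' i - c' i θ • d, d, ⟨?_, ?_, ?_⟩, hdδ, hd⟩
  · intro i; simp [hd]; simp [c', hα]
  · intro i j hij; simp [hd]; simp [c', hα, hij]
  · intro i; simp [hdδ, hcδ]

section base
variable {α : ι → V} {δ θ : V} {B : V →ₗ[ℝ] V →ₗ[ℝ] ℝ} {s : V → V ≃ₗ[ℝ] V}
  {c : ι → V →ₗ[ℝ] ℝ}

theorem coord_sum (hc : IsCoord α δ c) (t : ι → ℝ) (i : ι) : c i (∑ j, t j • α j) = t i := by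
  classical
  rw [map_sum, Finset.sum_eq_single i]
  · simp [hc.one]
  · intro j _ hj; simp [hc.zero i j hj.symm]
  · simp

theorem PosoComb.nonneg (hc : IsCoord α δ c) {v : V} (hv : PosoComb α v) (i : ι) : 0 ≤ c i v := by
  obtain ⟨t, ht, rfl⟩ := hv
  rw [coord_sum hc]; exact ht i

theorem simple_mem (i : ι) (J : Set ι) (hi : i ∈ J) : α i ∈ DeloJ α s J :=
  ⟨1, Subgroup.one_mem _, i, hi, rfl⟩

theorem simple_memo (i : ι) : α i ∈ Delo α s := simple_mem i _ trivial

theorem gen_mem (i : ι) (J : Set ι) (hi : i ∈ J) : s (α i) ∈ WoJ α s J :=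
  Subgroup.subset_closure ⟨i, hi, rfl⟩

theorem Wo_mono {J K : Set ι} (hKJ : K ⊆ J) : WoJ α s K ≤ WoJ α s J :=
  Subgroup.closure_mono (Set.image_mono hKJ)

theorem Delo_mono {J K : Set ι} (hKJ : K ⊆ J) : DeloJ α s K ⊆ DeloJ α s J := by
  rintro v ⟨g, hg, j, hj, rfl⟩
  exact ⟨g, Wo_mono hKJ hg, j, hKJ hj, rfl⟩

theorem W_mem {J : Set ι} {g : V ≃ₗ[ℝ] V} (hg : g ∈ WoJ α s J) {v : V}
    (hv : v ∈ DeloJ α s J) : g v ∈ DeloJ α s J := by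
  obtain ⟨w, hw, j, hj, rfl⟩ := hv
  exact ⟨g * w, Subgroup.mul_mem _ hg hw, j, hj, rfl⟩

theorem s_self (h : AffineSetup α δ θ B s) {a : V} (ha : a ∈ Delo α s) : s a a = -a := by
  have := h.Bpos a ha
  rw [h.refl_def a this.ne' a, mul_div_assoc, div_self this.ne']
  module

theorem s_sq (h : AffineSetup α δ θ B s) {a : V} (ha : a ∈ Delo α s) (v : V) :
    s a (s a v) = v := by
  have := h.Bpos a ha
  rw [h.refl_def a this.ne' v, map_sub, map_smul, s_self h ha, h.refl_def a this.ne' v]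
  module

theorem s_mul_self (h : AffineSetup α δ θ B s) (i : ι) : s (α i) * s (α i) = 1 := by
  ext v; exact s_sq h (simple_memo i) v

theorem s_inv (h : AffineSetup α δ θ B s) (i : ι) : (s (α i))⁻¹ = s (α i) :=
  inv_eq_of_mul_eq_one_left (s_mul_self h i)

theorem word_exists (h : AffineSetup α δ θ B s) {J : Set ι} {w : V ≃ₗ[ℝ] V}
    (hw : w ∈ WoJ α s J) :
    ∃ l : List ι, (∀ j ∈ l, j ∈ J) ∧ w = (l.map (fun j => s (α j))).prod := by
  unfold WoJ at hw
  induction hw using Subgroup.closure_induction with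
  | mem x hx =>
    obtain ⟨j, hj, rfl⟩ := hx
    exact ⟨[j], by simpa using hj, by simp⟩
  | one => exact ⟨[], by simp, by simp⟩
  | mul x y _ _ hx hy =>
    obtain ⟨l, hl, rfl⟩ := hx
    obtain ⟨m, hm, rfl⟩ := hy
    refine ⟨l ++ m, ?_, by simp⟩
    intro j hj
    rcases List.mem_append.1 hj with hj | hj
    · exact hl j hj
    · exact hm j hj
  | inv x _ hx =>
    obtain ⟨l, hl, rfl⟩ := hx
    refine ⟨l.reverse, by simpa using hl, ?_⟩
    rw [List.prod_inv_reverse, List.map_reverse, List.map_map]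
    congr 2
    apply List.map_congr_left
    intro j _
    exact s_inv h j

/-- Induction principle for the parabolic subgroups. -/
theorem W_induct (h : AffineSetup α δ θ B s) {J : Set ι} {P : (V ≃ₗ[ℝ] V) → Prop}
    (h1 : P 1) (hs : ∀ j ∈ J, ∀ w ∈ WoJ α s J, P w → P (s (α j) * w)) {w : V ≃ₗ[ℝ] V}
    (hw : w ∈ WoJ α s J) : P w := by
  obtain ⟨l, hl, rfl⟩ := word_exists h hw
  clear hw
  suffices P (l.map (fun j => s (α j))).prod ∧ (l.map (fun j => s (α j))).prod ∈ WoJ α s J from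
    this.1
  induction l with
  | nil => exact ⟨by simpa using h1, by simp⟩
  | cons j l ih =>
    have := ih (fun i hi => hl i (List.mem_cons_of_mem _ hi))
    have hj : j ∈ J := hl j (by simp)
    simp only [List.map_cons, List.prod_cons]
    exact ⟨hs j hj _ this.2 this.1, Subgroup.mul_mem _ (gen_mem j J hj) this.2⟩

theorem s_B (h : AffineSetup α δ θ B s) {a : V} (ha : a ∈ Delo α s) (x y : V) :
    B (s a x) y = B x (s a y) := by
  have := h.Bpos a ha
  rw [h.refl_def a this.ne', h.refl_def a this.ne']
  simp only [map_sub, map_smul, LinearMap.sub_apply, LinearMap.smul_apply, smul_eq_mul]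
  rw [h.Bsymm a y]; ring

theorem W_B (h : AffineSetup α δ θ B s) {w : V ≃ₗ[ℝ] V} (hw : w ∈ WoJ α s Set.univ) (x y : V) :
    B (w x) (w y) = B x y := by
  refine W_induct h (P := fun w => B (w x) (w y) = B x y) ?_ ?_ hw
  · rfl
  · intro j _ w _ ih
    simp only [LinearEquiv.mul_apply]
    rw [s_B h (simple_memo j), s_sq h (simple_memo j), ih]

theorem W_delta (h : AffineSetup α δ θ B s) {w : V ≃ₗ[ℝ] V} (hw : w ∈ WoJ α s Set.univ) :
    w δ = δ := by
  refine W_induct h (P := fun w => w δ = δ) ?_ ?_ hw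
  · rfl
  · intro j _ w _ ih
    simp only [LinearEquiv.mul_apply]
    rw [ih, h.refl_def _ (h.Bpos _ (simple_memo j)).ne', h.delta_orth]; simp

/-- General root reflections are conjugate to simple ones. -/
theorem s_conj (h : AffineSetup α δ θ B s) {w : V ≃ₗ[ℝ] V} (hw : w ∈ WoJ α s Set.univ)
    {a : V} (ha : a ∈ Delo α s) : s (w a) * w = w * s a := by
  have hpos := h.Bpos a ha
  ext v
  simp only [LinearEquiv.mul_apply]
  rw [h.refl_def (w a) (by rw [W_B h hw]; exact hpos.ne'), h.refl_def a hpos.ne', W_B h hw,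
    W_B h hw, map_sub, map_smul]

theorem s_mem_W (h : AffineSetup α δ θ B s) {a : V} (ha : a ∈ Delo α s) :
    s a ∈ WoJ α s Set.univ := by
  obtain ⟨w, hw, j, hj, rfl⟩ := ha
  have : s (w (α j)) = w * s (α j) * w⁻¹ := by
    rw [← s_conj h hw (simple_memo j)]; group
  rw [this]
  exact Subgroup.mul_mem _ (Subgroup.mul_mem _ hw (gen_mem j _ trivial)) (Subgroup.inv_mem _ hw)

theorem s_mem (h : AffineSetup α δ θ B s) {a : V} (ha : a ∈ Delo α s) {v : V}
    (hv : v ∈ Delo α s) : s a v ∈ Delo α s := W_mem (s_mem_W h ha) hv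

theorem neg_mem' (h : AffineSetup α δ θ B s) {J : Set ι} {v : V} (hv : v ∈ DeloJ α s J) :
    -v ∈ DeloJ α s J := by
  obtain ⟨w, hw, j, hj, rfl⟩ := hv
  refine ⟨w * s (α j), Subgroup.mul_mem _ hw (gen_mem j J hj), j, hj, ?_⟩
  simp only [LinearEquiv.mul_apply]
  rw [s_self h (simple_memo j), map_neg]

/-- Integrality of all pairings. -/
theorem pair_int (h : AffineSetup α δ θ B s) {a v : V} (ha : a ∈ Delo α s) (hv : v ∈ Delo α s) :
    ∃ m : ℤ, 2 * B v a / B a a = m := by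
  obtain ⟨w, hw, j, hj, rfl⟩ := ha
  have hw' := Subgroup.inv_mem _ hw
  have e : B v (w (α j)) = B (w⁻¹ v) (α j) := by
    rw [← W_B h hw (w⁻¹ v)]
    congr 2
    exact (LinearEquiv.apply_symm_apply w v).symm
  rw [W_B h hw, e]
  obtain ⟨m, hm⟩ := h.cryst j (w⁻¹ v) (W_mem hw' hv)
  refine ⟨m, ?_⟩
  have hp := h.Bpos _ (simple_memo (s := s) (α := α) j)
  rw [h.refl_def _ hp.ne', ← Int.cast_smul_eq_zsmul ℝ] at hm
  have := congrArg (fun x => B x (α j)) (sub_right_injective hm)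
  simp only [map_smul, LinearMap.smul_apply, smul_eq_mul] at this
  exact mul_right_cancel₀ hp.ne' this

theorem W_span (h : AffineSetup α δ θ B s) {J : Set ι} {w : V ≃ₗ[ℝ] V} (hw : w ∈ WoJ α s J)
    {j : ι} (hj : j ∈ J) :
    ∃ n : ι → ℤ, (∀ i, i ∉ J → n i = 0) ∧ w (α j) = ∑ i, (n i : ℝ) • α i := by
  classical
  refine W_induct h (P := fun w => ∃ n : ι → ℤ, (∀ i, i ∉ J → n i = 0) ∧
    w (α j) = ∑ i, (n i : ℝ) • α i) ?_ ?_ hw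
  ·
    refine ⟨Pi.single j 1, ?_, ?_⟩
    · intro i hi
      have : i ≠ j := by rintro rfl; exact hi hj
      simp [this]
    · rw [Finset.sum_eq_single j]
      · simp
      · intro b _ hb; simp [hb]
      · simp
  · rintro k hk w hw ⟨n, hn, e⟩
    obtain ⟨m, hm⟩ := h.cryst k (w (α j)) ⟨w, Wo_mono (Set.subset_univ _) hw, j, trivial, rfl⟩
    refine ⟨n - Pi.single k m, ?_, ?_⟩
    · intro i hi
      have : i ≠ k := by rintro rfl; exact hi hk
      simp [this, hn i hi]
    · simp only [LinearEquiv.mul_apply]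
      rw [hm, e]
      simp only [Pi.sub_apply, Int.cast_sub, sub_smul, Finset.sum_sub_distrib]
      congr 1
      rw [Finset.sum_eq_single k]
      · simp [Int.cast_smul_eq_zsmul]
      · intro b _ hb; simp [hb]
      · simp

theorem DeloJ_supp (h : AffineSetup α δ θ B s) (hc : IsCoord α δ c) {J : Set ι} {v : V}
    (hv : v ∈ DeloJ α s J) (i : ι) (hi : i ∉ J) : c i v = 0 := by
  obtain ⟨w, hw, j, hj, rfl⟩ := hv
  obtain ⟨n, hn, e⟩ := W_span h hw hj
  rw [e, coord_sum hc, hn i hi]; simp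

theorem coord_int (h : AffineSetup α δ θ B s) (hc : IsCoord α δ c) {v : V}
    (hv : v ∈ Delo α s) (i : ι) : ∃ n : ℤ, c i v = n := by
  obtain ⟨w, hw, j, hj, rfl⟩ := hv
  obtain ⟨n, hn, e⟩ := W_span h hw hj
  exact ⟨n i, by rw [e, coord_sum hc]⟩

theorem root_expand (h : AffineSetup α δ θ B s) (hc : IsCoord α δ c) {v : V}
    (hv : v ∈ Delo α s) : v = ∑ i, c i v • α i := by
  obtain ⟨w, hw, j, hj, rfl⟩ := hv
  obtain ⟨n, hn, e⟩ := W_span h hw hj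
  rw [e]
  simp only [coord_sum hc]

theorem delo_sub {J : Set ι} : DeloJ α s J ⊆ Delo α s := Delo_mono (Set.subset_univ _)

theorem root_ne_zero (h : AffineSetup α δ θ B s) {v : V} (hv : v ∈ Delo α s) : v ≠ 0 := by
  rintro rfl
  simpa using h.Bpos 0 hv

theorem poso_iff (h : AffineSetup α δ θ B s) (hc : IsCoord α δ c) {v : V}
    (hv : v ∈ Delo α s) : PosoComb α v ↔ ∀ i, 0 ≤ c i v :=
  ⟨fun hp => hp.nonneg hc, fun hp => ⟨fun i => c i v, hp, root_expand h hc hv⟩⟩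

/-- A root is positive or negative, in coordinates. -/
theorem root_sign (h : AffineSetup α δ θ B s) (hc : IsCoord α δ c) {v : V}
    (hv : v ∈ Delo α s) : (∀ i, 0 ≤ c i v) ∨ (∀ i, c i v ≤ 0) := by
  rcases h.base v hv with ⟨hp, -⟩ | ⟨hp, -⟩
  · exact Or.inl (hp.nonneg hc)
  · right; intro i
    have := hp.nonneg hc i
    rw [map_neg] at this; linarith

theorem root_coord_ne (h : AffineSetup α δ θ B s) (hc : IsCoord α δ c) {v : V}
    (hv : v ∈ Delo α s) : ∃ i, c i v ≠ 0 := by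
  by_contra! hn
  apply root_ne_zero h hv
  rw [root_expand h hc hv]; simp [hn]

/-- A positive root supported at one vertex is simple. -/
theorem root_multiple (h : AffineSetup α δ θ B s) (hc : IsCoord α δ c) {v : V}
    (hv : v ∈ Delo α s) (i : ι) (hi : ∀ j, j ≠ i → c j v = 0) (hp : 0 ≤ c i v) : v = α i := by
  have e : v = c i v • α i := by
    conv_lhs => rw [root_expand h hc hv]
    rw [Finset.sum_eq_single i]
    · intro b _ hb; simp [hi b hb]
    · simp
  obtain ⟨n, hn⟩ := coord_int h hc hv i
  rw [hn] at e hp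
  have hv' := hv
  obtain ⟨w, hw, j, hj, rfl⟩ := hv
  have hr : w⁻¹ (α i) ∈ Delo α s := W_mem (Subgroup.inv_mem _ hw) (simple_memo i)
  obtain ⟨m, hm⟩ := coord_int h hc hr j
  have e2 : α j = (n : ℝ) • w⁻¹ (α i) := by
    rw [← map_smul, ← e]; exact (LinearEquiv.symm_apply_apply w (α j)).symm
  have e3 := congrArg (c j) e2
  rw [hc.one, map_smul, hm, smul_eq_mul] at e3
  have e4 : n * m = 1 := by exact_mod_cast e3.symm
  have hn0 : 0 ≤ n := by exact_mod_cast hp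
  have : n = 1 := by
    rcases Int.eq_one_or_neg_one_of_mul_eq_one e4 with h1 | h1 <;> omega
  rw [e, this]; simp

end base

section more
variable {α : ι → V} {δ θ : V} {B : V →ₗ[ℝ] V →ₗ[ℝ] ℝ} {s : V → V ≃ₗ[ℝ] V}
  {c : ι → V →ₗ[ℝ] ℝ}

/-- An auxiliary positive semidefinite invariant form. -/
noncomputable def auxQ (h : AffineSetup α δ θ B s) (x y : V) : ℝ :=
  ∑ r ∈ h.finite.toFinset, B x r * B y r

theorem auxQ_s (h : AffineSetup α δ θ B s) {a : V} (ha : a ∈ Delo α s) (x y : V) :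
    auxQ h (s a x) (s a y) = auxQ h x y := by
  unfold auxQ
  refine Finset.sum_nbij' (fun r => s a r) (fun r => s a r) ?_ ?_ ?_ ?_ ?_
  · intro r hr; simp only [Set.Finite.mem_toFinset] at *; exact s_mem h ha hr
  · intro r hr; simp only [Set.Finite.mem_toFinset] at *; exact s_mem h ha hr
  · intro r _; exact s_sq h ha r
  · intro r _; exact s_sq h ha r
  · intro r _; rw [s_B h ha, s_B h ha]

theorem auxQ_pos (h : AffineSetup α δ θ B s) {a : V} (ha : a ∈ Delo α s) : 0 < auxQ h a a := by
  unfold auxQ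
  apply Finset.sum_pos'
  · intro r _; exact mul_self_nonneg _
  · exact ⟨a, by simpa using ha, mul_pos (h.Bpos a ha) (h.Bpos a ha)⟩

theorem auxQ_pair (h : AffineSetup α δ θ B s) {a : V} (ha : a ∈ Delo α s) (v : V) :
    2 * auxQ h v a = (2 * B v a / B a a) * auxQ h a a := by
  have e := auxQ_s h ha v a
  rw [s_self h ha, h.refl_def a (h.Bpos a ha).ne'] at e
  have : auxQ h (v - (2 * B v a / B a a) • a) (-a)
      = - auxQ h v a + (2 * B v a / B a a) * auxQ h a a := by
    unfold auxQ
    rw [Finset.mul_sum, ← Finset.sum_neg_distrib, ← Finset.sum_add_distrib]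
    apply Finset.sum_congr rfl
    intro r _
    simp only [map_sub, map_neg, map_smul, LinearMap.sub_apply, LinearMap.smul_apply,
      LinearMap.neg_apply, smul_eq_mul]
    ring
  linarith

theorem auxQ_symm (h : AffineSetup α δ θ B s) (x y : V) : auxQ h x y = auxQ h y x := by
  unfold auxQ
  exact Finset.sum_congr rfl fun r _ => mul_comm _ _

theorem pair_le_four (h : AffineSetup α δ θ B s) {a b : V} (ha : a ∈ Delo α s)
    (hb : b ∈ Delo α s) : (2 * B a b / B b b) * (2 * B b a / B a a) ≤ 4 := by
  have h1 := auxQ_pair h hb a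
  have h2 := auxQ_pair h ha b
  rw [auxQ_symm h b a] at h2
  have cs : auxQ h a b ^ 2 ≤ auxQ h a a * auxQ h b b := by
    have := Finset.sum_mul_sq_le_sq_mul_sq h.finite.toFinset (fun r => B a r) (fun r => B b r)
    simpa only [auxQ, pow_two] using this
  have pa := auxQ_pos h ha
  have pb := auxQ_pos h hb
  set p := 2 * B a b / B b b
  set q := 2 * B b a / B a a
  have : p * q * (auxQ h a a * auxQ h b b) = 4 * auxQ h a b ^ 2 := by
    calc p * q * (auxQ h a a * auxQ h b b) = (p * auxQ h b b) * (q * auxQ h a a) := by ring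
      _ = 4 * auxQ h a b ^ 2 := by rw [← h1, ← h2]; ring
  have pp := mul_pos pa pb
  by_contra! hlt
  nlinarith

theorem root_sub (h : AffineSetup α δ θ B s) {a b : V} (ha : a ∈ Delo α s)
    (hb : b ∈ Delo α s) (hab : 0 < B a b) (hne : a ≠ b) : a - b ∈ Delo α s := by
  have pa := h.Bpos a ha
  have pb := h.Bpos b hb
  obtain ⟨p, hp⟩ := pair_int h hb ha
  obtain ⟨q, hq⟩ := pair_int h ha hb
  have hle := pair_le_four h ha hb
  have hba : 0 < B b a := by rw [h.Bsymm]; exact hab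
  have p0 : 0 < 2 * B a b / B b b := by positivity
  have q0 : 0 < 2 * B b a / B a a := by positivity
  have sb := h.refl_def b pb.ne' a
  have sa := h.refl_def a pa.ne' b
  rw [hp] at sb p0 hle
  rw [hq] at sa q0 hle
  have p0' : 0 < p := by exact_mod_cast p0
  have q0' : 0 < q := by exact_mod_cast q0
  have hle' : p * q ≤ 4 := by exact_mod_cast hle
  have hcase : p = 1 ∨ q = 1 ∨ (p = 2 ∧ q = 2) := by
    by_contra! hn
    obtain ⟨h1, h2, h3⟩ := hn
    have hp2 : 2 ≤ p := by omega
    have hq2 : 2 ≤ q := by omega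
    have : p ≤ 2 := by nlinarith
    have : q ≤ 2 := by nlinarith
    exact h3 (by omega) (by omega)
  rcases hcase with h1 | h1 | ⟨h1, h2⟩
  · have := s_mem h hb ha
    rw [sb, h1] at this; simpa using this
  · have := s_mem h ha hb
    rw [sa, h1] at this
    have : -(b - ((1 : ℤ) : ℝ) • a) ∈ Delo α s := neg_mem' h this
    simpa using this
  · exfalso
    apply hne
    have : IsAddTorsionFree V := .of_isTorsionFree ℝ V
    have key : ∀ x : V, x ∈ Delo α s → ∀ v : V,
        Module.preReflection x ((2 / B x x) • B.flip x) v = s x v := by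
      intro x hx v
      rw [Module.preReflection_apply, h.refl_def x (h.Bpos x hx).ne']
      simp only [LinearMap.smul_apply, LinearMap.flip_apply, smul_eq_mul]
      congr 2; ring
    refine Module.eq_of_mapsTo_reflection_of_mem (R := ℝ) (f := (2 / B a a) • B.flip a)
      (g := (2 / B b b) • B.flip b) (Φ := Delo α s) h.finite ?_ ?_ ?_ ?_ ?_ ?_ hb
    · simp only [LinearMap.smul_apply, LinearMap.flip_apply, smul_eq_mul]; field_simp
    · simp only [LinearMap.smul_apply, LinearMap.flip_apply, smul_eq_mul]; field_simp
    · simp only [LinearMap.smul_apply, LinearMap.flip_apply, smul_eq_mul]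
      rw [h1] at hp; rw [div_mul_eq_mul_div, hp]; simp
    · simp only [LinearMap.smul_apply, LinearMap.flip_apply, smul_eq_mul]
      rw [h2] at hq; rw [div_mul_eq_mul_div, hq]; simp
    · intro v hv; rw [key a ha]; exact s_mem h ha hv
    · intro v hv; rw [key b hb]; exact s_mem h hb hv

theorem B_expand (h : AffineSetup α δ θ B s) (hc : IsCoord α δ c) {v : V}
    (hv : v ∈ Delo α s) (x : V) : B x v = ∑ i, c i v * B x (α i) := by
  conv_lhs => rw [root_expand h hc hv]
  simp

theorem exists_desc (h : AffineSetup α δ θ B s) (hc : IsCoord α δ c) {v : V}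
    (hv : v ∈ Delo α s) (hp : ∀ i, 0 ≤ c i v) : ∃ i, 0 < c i v ∧ 0 < B v (α i) := by
  by_contra! hn
  have := h.Bpos v hv
  rw [B_expand h hc hv] at this
  have : ∑ i, c i v * B v (α i) ≤ 0 := by
    apply Finset.sum_nonpos
    intro i _
    rcases (hp i).eq_or_lt with h0 | h0
    · rw [← h0]; simp
    · exact mul_nonpos_of_nonneg_of_nonpos (hp i) (hn i h0)
  linarith

theorem s_coord (h : AffineSetup α δ θ B s) (hc : IsCoord α δ c) (v : V) {i j : ι}
    (hij : j ≠ i) : c j (s (α i) v) = c j v := by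
  rw [h.refl_def _ (h.Bpos _ (simple_memo i)).ne', map_sub, map_smul, hc.zero j i hij]; simp

/-- A positive root made negative by a simple reflection is that simple root. -/
theorem eq_simple (h : AffineSetup α δ θ B s) (hc : IsCoord α δ c) {v : V}
    (hv : v ∈ Delo α s) (hp : ∀ i, 0 ≤ c i v) {i : ι} (hn : ∀ j, c j (s (α i) v) ≤ 0) :
    v = α i := by
  apply root_multiple h hc hv i _ (hp i)
  intro j hj
  have := hn j
  rw [s_coord h hc v hj] at this
  exact le_antisymm this (hp j)

theorem mem_of_supp_pos (h : AffineSetup α δ θ B s) (hc : IsCoord α δ c) (K : Set ι) (n : ℕ) :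
    ∀ v ∈ Delo α s, (∀ i, 0 ≤ c i v) → (∀ i, i ∉ K → c i v = 0) → ∑ i, c i v ≤ n →
      v ∈ DeloJ α s K := by
  induction n with
  | zero =>
    intro v hv hp _ hs
    obtain ⟨i, hi⟩ := root_coord_ne h hc hv
    have h1 : c i v ≤ ∑ i, c i v :=
      Finset.single_le_sum (f := fun i => c i v) (fun j _ => hp j) (Finset.mem_univ i)
    simp only [Nat.cast_zero] at hs
    exact absurd (le_antisymm (h1.trans hs) (hp i)) hi
  | succ n ih =>
    intro v hv hp hK hs
    obtain ⟨i, hi, hB⟩ := exists_desc h hc hv hp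
    have hiK : i ∈ K := by
      by_contra hh; rw [hK i hh] at hi; exact lt_irrefl _ hi
    have hsv : s (α i) v ∈ Delo α s := s_mem h (simple_memo i) hv
    rcases root_sign h hc hsv with hsgn | hsgn
    · have : s (α i) v ∈ DeloJ α s K := by
        apply ih _ hsv hsgn
        · intro j hj
          have hji : j ≠ i := by rintro rfl; exact hj hiK
          rw [s_coord h hc v hji, hK j hj]
        · obtain ⟨m, hm⟩ := pair_int h (simple_memo i) hv
          have hpp := h.Bpos _ (simple_memo (s := s) (α := α) i)
          have hm0 : 0 < 2 * B v (α i) / B (α i) (α i) := by positivity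
          rw [hm] at hm0
          have hm1 : (1 : ℝ) ≤ m := by
            have : 0 < m := by exact_mod_cast hm0
            exact_mod_cast this
          rw [h.refl_def _ hpp.ne', hm]
          simp only [map_sub, map_smul, smul_eq_mul, Finset.sum_sub_distrib, ← Finset.mul_sum]
          have : ∑ j, c j (α i) = 1 := by
            rw [Finset.sum_eq_single i]
            · exact hc.one i
            · intro b _ hb; exact hc.zero b i hb
            · simp
          rw [this]
          push_cast at hs
          linarith
      rw [← s_sq h (simple_memo i) v]
      exact W_mem (gen_mem i K hiK) this
    · rw [eq_simple h hc hv hp hsgn]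
      exact simple_mem i K hiK

theorem mem_of_supp (h : AffineSetup α δ θ B s) (hc : IsCoord α δ c) {K : Set ι} {v : V}
    (hv : v ∈ Delo α s) (hK : ∀ i, i ∉ K → c i v = 0) : v ∈ DeloJ α s K := by
  rcases root_sign h hc hv with hp | hp
  · obtain ⟨n, hn⟩ := exists_nat_ge (∑ i, c i v)
    exact mem_of_supp_pos h hc K n v hv hp hK hn
  · have hv' : -v ∈ Delo α s := neg_mem' h hv
    obtain ⟨n, hn⟩ := exists_nat_ge (∑ i, c i (-v))
    have := mem_of_supp_pos h hc K n (-v) hv' (by intro i; simpa using hp i)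
      (by intro i hi; simpa using hK i hi) hn
    simpa using neg_mem' h this

theorem exchange (h : AffineSetup α δ θ B s) (hc : IsCoord α δ c) (k : ι) (l : List ι)
    (hn : ∀ i, c i ((l.map (fun j => s (α j))).prod (α k)) ≤ 0) :
    ∃ l' : List ι, l'.length + 1 = l.length ∧
      (l'.map (fun j => s (α j))).prod = (l.map (fun j => s (α j))).prod * s (α k) := by
  induction l with
  | nil =>
    have := hn k
    simp only [List.map_nil, List.prod_nil, LinearEquiv.coe_one, id, hc.one] at this
    linarith
  | cons i l ih =>
    have hw : (l.map (fun j => s (α j))).prod ∈ WoJ α s Set.univ := by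
      apply Subgroup.list_prod_mem
      intro x hx
      obtain ⟨j, -, rfl⟩ := List.mem_map.1 hx
      exact gen_mem j _ trivial
    simp only [List.map_cons, List.prod_cons, LinearEquiv.mul_apply] at hn ⊢
    set w := (l.map (fun j => s (α j))).prod with hwd
    have hv : w (α k) ∈ Delo α s := W_mem hw (simple_memo k)
    rcases root_sign h hc hv with hp | hp
    · have e := eq_simple h hc hv hp hn
      refine ⟨l, by simp, ?_⟩
      have e2 := s_conj h hw (simple_memo k)
      rw [e] at e2
      rw [e2, mul_assoc, s_mul_self h, mul_one]
    · obtain ⟨l', hl', e⟩ := ih hp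
      refine ⟨i :: l', by simp [hl'], ?_⟩
      simp [e, mul_assoc]

theorem lift_list {β γ : Type*} (f : β → γ) (l : List γ) (hl : ∀ x ∈ l, x ∈ Set.range f) :
    ∃ m : List β, m.map f = l := by
  induction l with
  | nil => exact ⟨[], rfl⟩
  | cons a l ih =>
    obtain ⟨m, rfl⟩ := ih (fun x hx => hl x (List.mem_cons_of_mem _ hx))
    obtain ⟨b, rfl⟩ := hl a (by simp)
    exact ⟨b :: m, rfl⟩

theorem min_pos_simple (h : AffineSetup α δ θ B s) (hc : IsCoord α δ c) {J K : Set ι}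
    {u : V ≃ₗ[ℝ] V} (hu : u ∈ MinReps α s J K) {k : ι} (hk : k ∈ K) (i : ι) :
    0 ≤ c i (u (α k)) := by
  obtain ⟨huJ, hmin⟩ := hu
  have huU : u ∈ WoJ α s Set.univ := Wo_mono (Set.subset_univ _) huJ
  have hv : u (α k) ∈ Delo α s := W_mem huU (simple_memo k)
  rcases root_sign h hc hv with hp | hp
  · exact hp i
  · exfalso
    have hne : {n | ∃ l : List (V ≃ₗ[ℝ] V), (∀ x ∈ l, x ∈ Set.range fun i => s (α i)) ∧
        l.length = n ∧ l.prod = u}.Nonempty := by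
      obtain ⟨l, -, e⟩ := word_exists h huU
      refine ⟨_, l.map (fun j => s (α j)), ?_, rfl, e.symm⟩
      intro x hx
      obtain ⟨j, -, rfl⟩ := List.mem_map.1 hx
      exact ⟨j, rfl⟩
    obtain ⟨l, hl, hlen, hprod⟩ := Nat.sInf_mem hne
    obtain ⟨m, rfl⟩ := lift_list _ l hl
    rw [← hprod] at hp
    obtain ⟨l', hl', e⟩ := exchange h hc k m hp
    have h1 := hmin (s (α k)) (gen_mem k K hk)
    have h2 : lenG (Set.range fun i => s (α i)) (u * s (α k)) ≤ l'.length := by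
      apply Nat.sInf_le
      refine ⟨l'.map (fun j => s (α j)), ?_, by simp, by rw [e, hprod]⟩
      intro x hx
      obtain ⟨j, -, rfl⟩ := List.mem_map.1 hx
      exact ⟨j, rfl⟩
    have h3 : lenG (Set.range fun i => s (α i)) u = m.length := by
      unfold lenG; rw [← hlen]; simp
    omega

theorem min_pos (h : AffineSetup α δ θ B s) (hc : IsCoord α δ c) {J K : Set ι}
    {u : V ≃ₗ[ℝ] V} (hu : u ∈ MinReps α s J K) {v : V} (hv : v ∈ DeloJ α s K)
    (hp : ∀ i, 0 ≤ c i v) (i : ι) : 0 ≤ c i (u v) := by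
  rw [root_expand h hc (delo_sub hv)]
  simp only [map_sum, map_smul, smul_eq_mul]
  apply Finset.sum_nonneg
  intro j _
  by_cases hj : j ∈ K
  · exact mul_nonneg (hp j) (min_pos_simple h hc hu hj i)
  · rw [DeloJ_supp h hc hv j hj]; simp

theorem simple_B_nonpos (h : AffineSetup α δ θ B s) (hc : IsCoord α δ c) {i j : ι}
    (hij : i ≠ j) : B (α i) (α j) ≤ 0 := by
  by_contra! hn
  have hne : α i ≠ α j := by
    intro e
    have h1 := hc.zero i j hij
    rw [← e, hc.one] at h1; exact one_ne_zero h1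
  have := root_sub h (simple_memo i) (simple_memo j) hn hne
  rcases root_sign h hc this with hp | hp
  · have := hp j
    rw [map_sub, hc.one, hc.zero j i hij.symm] at this; linarith
  · have := hp i
    rw [map_sub, hc.one, hc.zero i j hij] at this; linarith

/-- Local maximality implies dominance. -/
theorem dominant_of_max (h : AffineSetup α δ θ B s) {v : V} (hv : v ∈ Delo α s) (j : ι)
    (hne : v ≠ -α j) (hmax : v + α j ∉ Delo α s) : 0 ≤ B v (α j) := by
  by_contra! hn
  have := root_sub h hv (neg_mem' h (simple_memo (s := s) j)) (by rw [map_neg]; linarith) hne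
  rw [sub_neg_eq_add] at this
  exact hmax this

theorem theta_mem (h : AffineSetup α δ θ B s) : θ ∈ Delo α s := h.theta_high.1

theorem theta_nonneg (h : AffineSetup α δ θ B s) (hc : IsCoord α δ c) (i : ι) : 0 ≤ c i θ :=
  h.theta_high.2.1.nonneg hc i

theorem theta_dom (h : AffineSetup α δ θ B s) (hc : IsCoord α δ c) (j : ι) :
    0 ≤ B θ (α j) := by
  apply dominant_of_max h (theta_mem h) j
  · intro e
    have := theta_nonneg h hc j
    rw [e, map_neg, hc.one] at this; linarith
  · exact h.theta_high.2.2 j trivial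

theorem theta_full (h : AffineSetup α δ θ B s) (hc : IsCoord α δ c) (j : ι) : 0 < c j θ := by
  have hA : {i | 0 < c i θ} = ∅ ∨ {i | 0 < c i θ} = Set.univ := by
    apply h.irred
    intro i hi j hj
    simp only [Set.mem_compl_iff, Set.mem_ofPred_eq, not_lt] at hi hj
    have hj0 : c j θ = 0 := le_antisymm hj (theta_nonneg h hc j)
    have h1 := theta_dom h hc j
    rw [h.Bsymm, B_expand h hc (theta_mem h)] at h1
    have hle : ∀ k ∈ Finset.univ, c k θ * B (α j) (α k) ≤ 0 := by
      intro k _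
      by_cases hk : k = j
      · rw [hk, hj0]; simp
      · exact mul_nonpos_of_nonneg_of_nonpos (theta_nonneg h hc k)
          (simple_B_nonpos h hc (Ne.symm hk))
    have h0 := (Finset.sum_eq_zero_iff_of_nonpos hle).1
      (le_antisymm (Finset.sum_nonpos hle) h1) i (Finset.mem_univ i)
    have hB : B (α j) (α i) = 0 := by
      rcases mul_eq_zero.1 h0 with h0 | h0
      · exact absurd h0 hi.ne'
      · exact h0
    rw [h.refl_def _ (h.Bpos _ (simple_memo i)).ne', hB]; simp
  rcases hA with hA | hA
  · exfalso
    obtain ⟨i, hi⟩ := root_coord_ne h hc (theta_mem h)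
    have : i ∈ {i | 0 < c i θ} := lt_of_le_of_ne (theta_nonneg h hc i) (Ne.symm hi)
    rw [hA] at this; exact this
  · have : j ∈ {i | 0 < c i θ} := by rw [hA]; trivial
    exact this

theorem int_pos_one (h : AffineSetup α δ θ B s) (hc : IsCoord α δ c) {v : V}
    (hv : v ∈ Delo α s) {i : ι} (hi : 0 < c i v) : 1 ≤ c i v := by
  obtain ⟨n, hn⟩ := coord_int h hc hv i
  rw [hn] at hi ⊢
  have : 0 < n := by exact_mod_cast hi
  exact_mod_cast this

theorem sum_simple (hc : IsCoord α δ c) (i : ι) : ∑ j, c j (α i) = 1 := by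
  rw [Finset.sum_eq_single i]
  · exact hc.one i
  · intro b _ hb; exact hc.zero b i hb
  · simp

theorem theta_max (h : AffineSetup α δ θ B s) (hc : IsCoord α δ c) (n : ℕ) :
    ∀ v ∈ Delo α s, (∀ i, c i θ ≤ c i v) → ∑ i, c i (v - θ) ≤ n → v = θ := by
  induction n with
  | zero =>
    intro v hv hp hs
    simp only [Nat.cast_zero] at hs
    have hnn : ∀ i ∈ Finset.univ, 0 ≤ c i (v - θ) := by
      intro i _; rw [map_sub]; linarith [hp i]
    have h0 := (Finset.sum_eq_zero_iff_of_nonneg hnn).1 (le_antisymm hs (Finset.sum_nonneg hnn))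
    rw [root_expand h hc hv]
    conv_rhs => rw [root_expand h hc (theta_mem h)]
    apply Finset.sum_congr rfl
    intro i hi
    have := h0 i hi
    rw [map_sub] at this
    rw [sub_eq_zero.1 this]
  | succ n ih =>
    intro v hv hp hs
    by_contra hne
    have hB : 0 < B v θ := by
      have h1 : B θ v = ∑ i, c i v * B θ (α i) := B_expand h hc hv θ
      have h2 := B_expand h hc (theta_mem h) θ
      have h3 := h.Bpos θ (theta_mem h)
      rw [h.Bsymm, h1]
      rw [h2] at h3
      refine lt_of_lt_of_le h3 (Finset.sum_le_sum fun i _ => ?_)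
      exact mul_le_mul_of_nonneg_right (hp i) (theta_dom h hc i)
    have hg := root_sub h hv (theta_mem h) hB hne
    obtain ⟨j, hj, hBj⟩ := exists_desc h hc hg (by intro i; rw [map_sub]; linarith [hp i])
    have hj1 := int_pos_one h hc hg hj
    rw [map_sub] at hj1
    have hBv : 0 < B v (α j) := by
      rw [map_sub, LinearMap.sub_apply] at hBj
      linarith [theta_dom h hc j]
    have hvj : v ≠ α j := by
      rintro rfl
      rw [hc.one] at hj1
      linarith [theta_full h hc j]
    have hr := root_sub h hv (simple_memo j) hBv hvj
    have := ih _ hr ?_ ?_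
    · apply h.theta_high.2.2 j trivial
      rw [← this, sub_add_cancel]; exact hv
    · intro i
      rw [map_sub]
      by_cases hij : i = j
      · subst hij; rw [hc.one]; linarith
      · rw [hc.zero i j hij]; linarith [hp i]
    · have : ∀ i, c i (v - α j - θ) = c i (v - θ) - c i (α j) := by
        intro i; simp only [map_sub]; ring
      simp only [this, Finset.sum_sub_distrib, sum_simple hc]
      push_cast at hs
      linarith

/-- The highest root dominates every root. -/
theorem theta_ge (h : AffineSetup α δ θ B s) (hc : IsCoord α δ c) {v : V}
    (hv : v ∈ Delo α s) (i : ι) : c i v ≤ c i θ := by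
  by_contra! hcon
  let S : Set V := {v ∈ Delo α s | ∃ i, c i θ < c i v}
  have hS : S.Finite := h.finite.subset fun v hv => hv.1
  obtain ⟨e, ⟨he, k, hk⟩, hmax⟩ := Set.exists_max_image S (fun v => ∑ i, c i v) hS
    ⟨v, hv, i, hcon⟩
  have hmax' : ∀ j, e + α j ∉ Delo α s := by
    intro j hj
    have := hmax (e + α j) ⟨hj, k, by
      rw [map_add]
      by_cases hkj : k = j
      · subst hkj; rw [hc.one]; linarith
      · rw [hc.zero k j hkj]; linarith⟩
    simp only [map_add, Finset.sum_add_distrib, sum_simple hc] at this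
    linarith
  have hdom : ∀ j, 0 ≤ B e (α j) := by
    intro j
    apply dominant_of_max h he j _ (hmax' j)
    rintro rfl
    have h1 := theta_nonneg h hc k
    rw [map_neg] at hk
    by_cases hkj : k = j
    · subst hkj; rw [hc.one] at hk; linarith
    · rw [hc.zero k j hkj] at hk; linarith
  have hB : 0 < B e θ := by
    have e1 := B_expand h hc (theta_mem h) e
    have hnn : ∀ i ∈ Finset.univ, 0 ≤ c i θ * B e (α i) := fun i _ =>
      mul_nonneg (theta_nonneg h hc i) (hdom i)
    rcases (Finset.sum_nonneg hnn).eq_or_lt with h0 | h0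
    · exfalso
      have h1 := (Finset.sum_eq_zero_iff_of_nonneg hnn).1 h0.symm
      have h2 : ∀ i, B e (α i) = 0 := by
        intro i
        rcases mul_eq_zero.1 (h1 i (Finset.mem_univ i)) with h3 | h3
        · exact absurd h3 (theta_full h hc i).ne'
        · exact h3
      have h3 := h.Bpos e he
      rw [B_expand h hc he] at h3
      simp [h2] at h3
    · rw [e1]; exact h0
  have hne : e ≠ θ := by rintro rfl; exact lt_irrefl _ hk
  have hr := root_sub h he (theta_mem h) hB hne
  rcases root_sign h hc hr with hp | hp
  · obtain ⟨n, hn⟩ := exists_nat_ge (∑ i, c i (e - θ))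
    exact hne (theta_max h hc n e he (by intro i; have := hp i; rw [map_sub] at this; linarith) hn)
  · have := hp k
    rw [map_sub] at this; linarith

end more

section final
variable {α : ι → V} {δ θ : V} {B : V →ₗ[ℝ] V →ₗ[ℝ] ℝ} {s : V → V ≃ₗ[ℝ] V}
  {c : ι → V →ₗ[ℝ] ℝ} {d : V →ₗ[ℝ] ℝ}

theorem posComb_iff (h : AffineSetup α δ θ B s) (hc : IsCoord α δ c) (hd : d δ = 1)
    (hdα : ∀ i, d (α i) = 0) {e : V} (he : e ∈ Delo α s) (m : ℕ) :
    PosComb α δ θ ((m : ℤ) • δ + e) ↔ (0 < m ∨ ∀ i, 0 ≤ c i e) := by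
  have hdr : ∀ v ∈ Delo α s, d v = 0 := by
    intro v hv
    rw [root_expand h hc hv]; simp [hdα]
  constructor
  · rintro ⟨t, ht, e1⟩
    rcases Nat.eq_zero_or_pos m with rfl | hm
    · right
      rw [Fintype.sum_option] at e1
      simp only [alHat, Option.elim_none, Option.elim_some, Nat.cast_zero, zero_smul,
        zero_add] at e1
      have e2 := congrArg d e1
      simp only [map_add, map_smul, map_sub, map_sum, hd, hdα, hdr e he, hdr θ (theta_mem h),
        smul_eq_mul] at e2
      simp at e2
      rw [← e2, zero_smul, zero_add] at e1
      intro i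
      rw [e1, coord_sum hc (fun j => t (some j))]
      exact ht _
    · exact Or.inl hm
  · intro hh
    refine ⟨fun o => o.elim (m : ℝ) (fun i => m * c i θ + c i e), ?_, ?_⟩
    · rintro (_ | i)
      · simp
      · simp only [Option.elim_some]
        have h1 := theta_nonneg h hc i
        have h2 := theta_ge h hc (neg_mem' h he) i
        rw [map_neg] at h2
        rcases hh with hm | hp
        · have : (1 : ℝ) ≤ m := by exact_mod_cast hm
          nlinarith
        · have := hp i
          positivity
    · rw [Fintype.sum_option]
      simp only [alHat, Option.elim_none, Option.elim_some, add_smul, Finset.sum_add_distrib,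
        mul_smul, ← Finset.smul_sum]
      rw [← root_expand h hc he, ← root_expand h hc (theta_mem h), natCast_zsmul,
        ← Nat.cast_smul_eq_nsmul ℝ]
      module

theorem mem_brSet (h : AffineSetup α δ θ B s) (hc : IsCoord α δ c) (hd : d δ = 1)
    (hdα : ∀ i, d (α i) = 0) {P : Set V} (hP : P ⊆ Delo α s) (v : V) :
    v ∈ brSet α δ θ s P ↔
      ∃ m : ℕ, ∃ e ∈ P, v = (m : ℤ) • δ + e ∧ (0 < m ∨ ∀ i, 0 ≤ c i e) := by
  unfold brSet brkt
  simp only [Set.mem_iUnion]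
  constructor
  · rintro ⟨e, he, ⟨m, hm⟩, hr⟩
    refine ⟨m, e, he, hm, ?_⟩
    rw [← posComb_iff h hc hd hdα (hP he), ← hm]
    exact hr.2.2
  · rintro ⟨m, e, he, hm, hr⟩
    rw [← posComb_iff h hc hd hdα (hP he), ← hm] at hr
    have hre : v ∈ DelRe α δ s := ⟨m, e, hP he, hm⟩
    exact ⟨e, he, ⟨m, hm⟩, hre, Or.inl hre, hr⟩

theorem convex_core {A A0 D C : Set V} (F : V →ₗ[ℝ] ℝ) (h0 : ∀ x, x ∈ A0 ↔ x ∈ A ∧ F x = 0)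
    (hD : ∀ x, x ∈ D ↔ x ∈ A ∧ 0 < F x) (hC : ConvexIn A0 C) : ConvexIn A (C ∪ D) := by
  have hC0 : ∀ x ∈ C, F x = 0 := fun x hx => ((h0 x).1 (hC.1 hx)).2
  have hD0 : ∀ x ∈ D, 0 < F x := fun x hx => ((hD x).1 hx).2
  constructor
  · rintro x (hx | hx)
    · exact ((h0 x).1 (hC.1 hx)).1
    · exact ((hD x).1 hx).1
  · rintro x (hx | hx) y (hy | hy) hxy
    · left
      apply hC.2 x hx y hy
      rw [h0]
      exact ⟨hxy, by rw [map_add, hC0 x hx, hC0 y hy, add_zero]⟩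
    · right
      rw [hD]
      exact ⟨hxy, by rw [map_add, hC0 x hx]; linarith [hD0 y hy]⟩
    · right
      rw [hD]
      exact ⟨hxy, by rw [map_add, hC0 y hy]; linarith [hD0 x hx]⟩
    · right
      rw [hD]
      exact ⟨hxy, by rw [map_add]; linarith [hD0 x hx, hD0 y hy]⟩

theorem biconvex_core {A A0 D E C : Set V} (F : V →ₗ[ℝ] ℝ)
    (h0 : ∀ x, x ∈ A0 ↔ x ∈ A ∧ F x = 0)
    (hD : ∀ x, x ∈ D ↔ x ∈ A ∧ 0 < F x) (hE : ∀ x, x ∈ E ↔ x ∈ A ∧ F x < 0)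
    (hC : BiconvexIn A0 C) : BiconvexIn A (C ∪ D) := by
  refine ⟨convex_core F h0 hD hC.1, ?_⟩
  have e : A \ (C ∪ D) = (A0 \ C) ∪ E := by
    ext x
    simp only [Set.mem_diff, Set.mem_union, h0, hD, hE]
    constructor
    · rintro ⟨hA, hx⟩
      push Not at hx
      rcases (hx.2 hA).eq_or_lt with h1 | h1
      · exact Or.inl ⟨⟨hA, h1⟩, hx.1⟩
      · exact Or.inr ⟨hA, h1⟩
    · rintro (⟨⟨hA, h1⟩, hx⟩ | ⟨hA, h1⟩)
      · exact ⟨hA, by rintro (h2 | h2); exacts [hx h2, by linarith [h2.2]]⟩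
      · refine ⟨hA, ?_⟩
        rintro (h2 | h2)
        · have := ((h0 x).1 (hC.1.1 h2)).2
          linarith
        · linarith [h2.2]
  rw [e]
  exact convex_core (-F) (by intro x; simp [h0]) (by intro x; simp [hE]) hC.2

open Classical in
/-- The sum of the coordinates outside `K`. -/
noncomputable def outK (c : ι → V →ₗ[ℝ] ℝ) (K : Set ι) : V →ₗ[ℝ] ℝ :=
  ∑ i ∈ Finset.univ.filter (fun i => i ∉ K), c i

theorem outK_delta (hc : IsCoord α δ c) (K : Set ι) : outK c K δ = 0 := by
  classical
  simp [outK, hc.delta]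

theorem outK_zero (h : AffineSetup α δ θ B s) (hc : IsCoord α δ c) {K : Set ι} {e : V}
    (he : e ∈ DeloJ α s K) : outK c K e = 0 := by
  classical
  simp only [outK, LinearMap.sum_apply]
  apply Finset.sum_eq_zero
  intro i hi
  exact DeloJ_supp h hc he i (by simpa using hi)

theorem outK_pos (h : AffineSetup α δ θ B s) (hc : IsCoord α δ c) {K : Set ι} {e : V}
    (he : e ∈ Delo α s) (hK : e ∉ DeloJ α s K) (hp : ∀ i, 0 ≤ c i e) : 0 < outK c K e := by
  classical
  simp only [outK, LinearMap.sum_apply]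
  have : ∃ i, i ∉ K ∧ c i e ≠ 0 := by
    by_contra! hn
    exact hK (mem_of_supp h hc he hn)
  obtain ⟨i, hi, hne⟩ := this
  exact Finset.sum_pos' (fun j _ => hp j)
    ⟨i, by simpa using hi, lt_of_le_of_ne (hp i) (Ne.symm hne)⟩

theorem outK_neg (h : AffineSetup α δ θ B s) (hc : IsCoord α δ c) {K : Set ι} {e : V}
    (he : e ∈ Delo α s) (hK : e ∉ DeloJ α s K) (hp : ∀ i, c i e ≤ 0) : outK c K e < 0 := by
  have := outK_pos h hc (K := K) (neg_mem' h he)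
    (fun hh => hK (by simpa using neg_mem' h hh)) (by intro i; simpa using hp i)
  rw [map_neg] at this; linarith

end final

/-- Proposition 5.11: for `K ⊆ J` and `u ∈ ∘W^K_J`: (1) if `C` is a convex set in
`uΔ_{K+}`, then `C ⊔ Δ^K_J(u, ±)` are convex sets in `Δ_{J+}`; (2) if `C` is a biconvex
set in `uΔ_{K+}`, then `C ⊔ Δ^K_J(u, ±)` are biconvex sets in `Δ_{J+}`. -/
theorem statement13 (α : ι → V) (δ θ : V) (B : V →ₗ[ℝ] V →ₗ[ℝ] ℝ) (s : V → V ≃ₗ[ℝ] V)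
    (h : AffineSetup α δ θ B s) (J K : Set ι) (hJ : J.Nonempty) (hKJ : K ⊆ J)
    (u : V ≃ₗ[ℝ] V) (hu : u ∈ MinReps α s J K) (C : Set V) :
    (ConvexIn (⇑u '' DelJPosB α δ θ s K) C →
      ConvexIn (DelJPosB α δ θ s J) (C ∪ DKJm α δ θ s J K u) ∧
        ConvexIn (DelJPosB α δ θ s J) (C ∪ DKJp α δ θ s J K u)) ∧
    (BiconvexIn (⇑u '' DelJPosB α δ θ s K) C →
      BiconvexIn (DelJPosB α δ θ s J) (C ∪ DKJm α δ θ s J K u) ∧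
        BiconvexIn (DelJPosB α δ θ s J) (C ∪ DKJp α δ θ s J K u)) := by
  obtain ⟨c, d, hc, hd, hdα⟩ := exists_coord h
  have huJ : u ∈ WoJ α s J := hu.1
  have huU : u ∈ WoJ α s Set.univ := Wo_mono (Set.subset_univ _) huJ
  have huδ : u δ = δ := W_delta h huU
  have hinv : ∀ x, u.symm (u x) = x := u.symm_apply_apply
  have huz : ∀ (m : ℕ) (e : V), u ((m : ℤ) • δ + e) = (m : ℤ) • δ + u e := by
    intro m e; rw [map_add, map_zsmul, huδ]
  let F : V →ₗ[ℝ] ℝ := (outK c K).comp (u.symm : V →ₗ[ℝ] V)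
  have hF : ∀ (m : ℕ) (e : V), F ((m : ℤ) • δ + u e) = outK c K e := by
    intro m e
    rw [← huz]
    change outK c K (u.symm (u _)) = _
    rw [hinv, map_add, map_zsmul, outK_delta hc, smul_zero, zero_add]
  have hFδ : ∀ m : ℕ, F ((m : ℤ) • δ) = 0 := by
    intro m
    have := hF m 0
    simpa using this
  have hKo : DeloJ α s K ⊆ Delo α s := delo_sub
  have hJo : DeloJ α s J ⊆ Delo α s := delo_sub
  have hpre : ∀ e ∈ DeloJ α s J, ∃ e' ∈ DeloJ α s J, u e' = e := fun e he =>
    ⟨u⁻¹ e, W_mem (Subgroup.inv_mem _ huJ) he, u.apply_symm_apply e⟩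
  have himg : ∀ P : Set V, P ⊆ DeloJ α s J → ⇑u '' P ⊆ Delo α s := by
    rintro P hP _ ⟨x, hx, rfl⟩
    exact hJo (W_mem huJ (hP hx))
  have h0 : ∀ x, x ∈ ⇑u '' DelJPosB α δ θ s K ↔ x ∈ DelJPosB α δ θ s J ∧ F x = 0 := by
    intro x
    constructor
    · rintro ⟨y, hy, rfl⟩
      rcases hy with hy | ⟨m, hm, rfl⟩
      · rw [mem_brSet h hc hd hdα hKo] at hy
        obtain ⟨m, e, he, rfl, hor⟩ := hy
        rw [huz]
        refine ⟨Or.inl ?_, by rw [hF, outK_zero h hc he]⟩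
        rw [mem_brSet h hc hd hdα hJo]
        exact ⟨m, u e, W_mem huJ (Delo_mono hKJ he), rfl, hor.imp id (min_pos h hc hu he)⟩
      · rw [map_zsmul, huδ]
        exact ⟨Or.inr ⟨m, hm, rfl⟩, hFδ m⟩
    · rintro ⟨hx | ⟨m, hm, rfl⟩, hFx⟩
      · rw [mem_brSet h hc hd hdα hJo] at hx
        obtain ⟨m, e, he, rfl, hor⟩ := hx
        obtain ⟨e', he', rfl⟩ := hpre e he
        rw [hF] at hFx
        have heK : e' ∈ DeloJ α s K := by
          by_contra hn
          rcases root_sign h hc (hJo he') with hp | hp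
          · linarith [outK_pos h hc (hJo he') hn hp]
          · linarith [outK_neg h hc (hJo he') hn hp]
        refine ⟨(m : ℤ) • δ + e', Or.inl ?_, huz m e'⟩
        rw [mem_brSet h hc hd hdα hKo]
        refine ⟨m, e', heK, rfl, hor.imp id fun hpos => ?_⟩
        rcases root_sign h hc (hJo he') with hp | hp
        · exact hp
        · exfalso
          have h1 := min_pos h hc hu (neg_mem' h heK) (by intro i; simpa using hp i)
          obtain ⟨i, hi⟩ := root_coord_ne h hc (hJo he)
          have h2 := h1 i
          rw [map_neg, map_neg] at h2
          exact hi (le_antisymm (by linarith) (hpos i))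
      · exact ⟨(m : ℤ) • δ, Or.inr ⟨m, hm, rfl⟩, by rw [map_zsmul, huδ]⟩
  have hsubp : DeloKJpos α s J K ⊆ DeloJ α s J := fun x hx => hx.1.1
  have hsubm : DeloKJneg α s J K ⊆ DeloJ α s J := fun x hx => hx.1.1
  have hP : ∀ x, x ∈ DKJp α δ θ s J K u ↔ x ∈ DelJPosB α δ θ s J ∧ 0 < F x := by
    intro x
    unfold DKJp
    rw [mem_brSet h hc hd hdα (himg _ hsubp)]
    constructor
    · rintro ⟨m, _, ⟨e, he, rfl⟩, rfl, hor⟩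
      refine ⟨Or.inl ?_, ?_⟩
      · rw [mem_brSet h hc hd hdα hJo]
        exact ⟨m, u e, W_mem huJ (hsubp he), rfl, hor⟩
      · rw [hF]
        exact outK_pos h hc (hJo (hsubp he)) he.1.2 (PosoComb.nonneg hc he.2)
    · rintro ⟨hx | ⟨m, hm, rfl⟩, hFx⟩
      · rw [mem_brSet h hc hd hdα hJo] at hx
        obtain ⟨m, e, he, rfl, hor⟩ := hx
        obtain ⟨e', he', rfl⟩ := hpre e he
        rw [hF] at hFx
        have hn : e' ∉ DeloJ α s K := fun hh => by
          rw [outK_zero h hc hh] at hFx; exact lt_irrefl _ hFx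
        refine ⟨m, u e', ⟨e', ⟨⟨he', hn⟩, ?_⟩, rfl⟩, rfl, hor⟩
        rcases root_sign h hc (hJo he') with hp | hp
        · exact (poso_iff h hc (hJo he')).2 hp
        · linarith [outK_neg h hc (hJo he') hn hp]
      · rw [hFδ] at hFx; exact absurd hFx (lt_irrefl _)
  have hM : ∀ x, x ∈ DKJm α δ θ s J K u ↔ x ∈ DelJPosB α δ θ s J ∧ F x < 0 := by
    intro x
    unfold DKJm
    rw [mem_brSet h hc hd hdα (himg _ hsubm)]
    constructor
    · rintro ⟨m, _, ⟨e, he, rfl⟩, rfl, hor⟩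
      refine ⟨Or.inl ?_, ?_⟩
      · rw [mem_brSet h hc hd hdα hJo]
        exact ⟨m, u e, W_mem huJ (hsubm he), rfl, hor⟩
      · rw [hF]
        refine outK_neg h hc (hJo (hsubm he)) he.1.2 fun i => ?_
        have := PosoComb.nonneg hc he.2 i
        rw [map_neg] at this; linarith
    · rintro ⟨hx | ⟨m, hm, rfl⟩, hFx⟩
      · rw [mem_brSet h hc hd hdα hJo] at hx
        obtain ⟨m, e, he, rfl, hor⟩ := hx
        obtain ⟨e', he', rfl⟩ := hpre e he
        rw [hF] at hFx
        have hn : e' ∉ DeloJ α s K := fun hh => by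
          rw [outK_zero h hc hh] at hFx; exact lt_irrefl _ hFx
        refine ⟨m, u e', ⟨e', ⟨⟨he', hn⟩, ?_⟩, rfl⟩, rfl, hor⟩
        rcases root_sign h hc (hJo he') with hp | hp
        · linarith [outK_pos h hc (hJo he') hn hp]
        · exact (poso_iff h hc (neg_mem' h (hJo he'))).2 (by intro i; simpa using hp i)
      · rw [hFδ] at hFx; exact absurd hFx (lt_irrefl _)
  have h0' : ∀ x, x ∈ ⇑u '' DelJPosB α δ θ s K ↔ x ∈ DelJPosB α δ θ s J ∧ (-F) x = 0 := by
    intro x; rw [h0]; simp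
  have hM' : ∀ x, x ∈ DKJm α δ θ s J K u ↔ x ∈ DelJPosB α δ θ s J ∧ 0 < (-F) x := by
    intro x; rw [hM]; simp
  have hP' : ∀ x, x ∈ DKJp α δ θ s J K u ↔ x ∈ DelJPosB α δ θ s J ∧ (-F) x < 0 := by
    intro x; rw [hP]; simp
  exact ⟨fun hC => ⟨convex_core (-F) h0' hM' hC, convex_core F h0 hP hC⟩,
    fun hC => ⟨biconvex_core (-F) h0' hM' hP' hC, biconvex_core F h0 hP hM hC⟩⟩

end
end

section
/- Let J ⊆ ∘I be nonempty. (1) Every real convex set B in Δ_{J+} is contained in Δ_J(w, −) for some w ∈ ∘W_J. (2) The assignment w ↦ Δ_J(w, −) is a bijection from ∘W_J onto the set of all maximal real convex sets in Δ_{J+} (with respect to inclusion), and this set coincides with the set of all maximal real biconvex sets in Δ_{J+}. -/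
open scoped Pointwise

section

variable {ι V : Type*} [Fintype ι] [Nonempty ι] [AddCommGroup V] [Module ℝ V]

/-- A real convex set in `A`: a convex set in `A` contained in `Δ^re₊`. -/
def RealConvexIn (α : ι → V) (δ θ : V) (s : V → V ≃ₗ[ℝ] V) (A B : Set V) : Prop :=
  ConvexIn A B ∧ B ⊆ DelRePos α δ θ s

/-- A real biconvex set in `A`. -/
def RealBiconvexIn (α : ι → V) (δ θ : V) (s : V → V ≃ₗ[ℝ] V) (A B : Set V) : Prop :=
  BiconvexIn A B ∧ B ⊆ DelRePos α δ θ s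

set_option linter.unusedSectionVars false

namespace AffAux

variable {α : ι → V} {δ θ : V} {B : V →ₗ[ℝ] V →ₗ[ℝ] ℝ} {s : V → V ≃ₗ[ℝ] V}

lemma WoJ_mono {J K : Set ι} (hJK : J ⊆ K) : WoJ α s J ≤ WoJ α s K :=
  Subgroup.closure_mono (Set.image_mono hJK)

lemma DeloJ_sub (J : Set ι) : DeloJ α s J ⊆ Delo α s := by
  rintro v ⟨g, hg, j, _, rfl⟩
  exact ⟨g, WoJ_mono (Set.subset_univ _) hg, j, Set.mem_univ _, rfl⟩

lemma simpleRefl_mem {J : Set ι} {j : ι} (hj : j ∈ J) : s (α j) ∈ WoJ α s J :=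
  Subgroup.subset_closure ⟨j, hj, rfl⟩

lemma simple_mem {J : Set ι} {j : ι} (hj : j ∈ J) : α j ∈ DeloJ α s J :=
  ⟨1, one_mem _, j, hj, rfl⟩

lemma act_mem {J : Set ι} {g : V ≃ₗ[ℝ] V} (hg : g ∈ WoJ α s J) {v : V}
    (hv : v ∈ DeloJ α s J) : g v ∈ DeloJ α s J := by
  obtain ⟨k, hk, j, hj, rfl⟩ := hv
  exact ⟨g * k, mul_mem hg hk, j, hj, rfl⟩


lemma Bsimple (h : AffineSetup α δ θ B s) (i : ι) : 0 < B (α i) (α i) := h.Bpos _ (simple_mem (Set.mem_univ i))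

lemma refl_simple (h : AffineSetup α δ θ B s) (i : ι) (v : V) :
    s (α i) v = v - (2 * B v (α i) / B (α i) (α i)) • α i :=
  h.refl_def _ (Bsimple h i).ne' v

lemma root_ne_zero (h : AffineSetup α δ θ B s) {v : V} (hv : v ∈ Delo α s) : v ≠ 0 := by
  rintro rfl
  have := h.Bpos _ hv
  simp at this

lemma refl_self (h : AffineSetup α δ θ B s) {a : V} (ha : B a a ≠ 0) : s a a = -a := by
  rw [h.refl_def a ha, mul_div_assoc, div_self ha]
  module

lemma refl_invol (h : AffineSetup α δ θ B s) {a : V} (ha : B a a ≠ 0) (v : V) : s a (s a v) = v := by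
  rw [h.refl_def a ha (s a v), h.refl_def a ha v]
  simp only [map_sub, map_smul, LinearMap.sub_apply, LinearMap.smul_apply, smul_eq_mul]
  have : 2 * (B v a - 2 * B v a / B a a * B a a) / B a a = - (2 * B v a / B a a) := by
    field_simp; ring
  rw [this]; module

lemma refl_mul_self (h : AffineSetup α δ θ B s) {a : V} (ha : B a a ≠ 0) : s a * s a = 1 := by
  ext v; exact refl_invol h ha v

lemma refl_inv (h : AffineSetup α δ θ B s) {a : V} (ha : B a a ≠ 0) : (s a)⁻¹ = s a :=
  inv_eq_of_mul_eq_one_left (refl_mul_self h ha)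

lemma refl_isom (h : AffineSetup α δ θ B s) {a : V} (ha : B a a ≠ 0) (u v : V) : B (s a u) (s a v) = B u v := by
  rw [h.refl_def a ha u, h.refl_def a ha v]
  simp only [map_sub, map_smul, LinearMap.sub_apply, LinearMap.smul_apply, smul_eq_mul]
  rw [h.Bsymm a v]
  field_simp; ring

/-- Left induction over words in the simple reflections. -/
lemma WoJ_induction (h : AffineSetup α δ θ B s) {J : Set ι} {p : (V ≃ₗ[ℝ] V) → Prop} (one : p 1)
    (step : ∀ j ∈ J, ∀ g ∈ WoJ α s J, p g → p (s (α j) * g)) {g : V ≃ₗ[ℝ] V}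
    (hg : g ∈ WoJ α s J) : p g := by
  unfold WoJ at hg
  induction hg using Subgroup.closure_induction_left with
  | one => exact one
  | mul_left x hx y hy ih =>
    obtain ⟨j, hj, rfl⟩ := hx
    exact step j hj y hy ih
  | inv_mul_cancel x hx y hy ih =>
    obtain ⟨j, hj, rfl⟩ := hx
    have := step j hj y hy ih
    simpa only [refl_inv h (Bsimple h j).ne'] using this

lemma WoJ_isom (h : AffineSetup α δ θ B s) {J : Set ι} {g : V ≃ₗ[ℝ] V} (hg : g ∈ WoJ α s J) (u v : V) :
    B (g u) (g v) = B u v := by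
  refine WoJ_induction h (p := fun g => B (g u) (g v) = B u v) rfl ?_ hg
  intro j _ g _ ih
  rw [← ih]
  exact refl_isom h (Bsimple h j).ne' _ _

lemma refl_conj (h : AffineSetup α δ θ B s) {J : Set ι} {g : V ≃ₗ[ℝ] V} (hg : g ∈ WoJ α s J) {a : V} (ha : B a a ≠ 0) :
    s (g a) = g * s a * g⁻¹ := by
  ext v
  have hga : B (g a) (g a) ≠ 0 := by rwa [WoJ_isom h hg]
  have hv : v = g (g⁻¹ v) := by
    change v = (g * g⁻¹) v
    simp
  change s (g a) v = g (s a (g⁻¹ v))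
  rw [h.refl_def _ hga, h.refl_def _ ha, WoJ_isom h hg, map_sub, map_smul, ← hv]
  conv_lhs => rw [hv, WoJ_isom h hg]
  rw [← hv]

lemma neg_mem (h : AffineSetup α δ θ B s) {J : Set ι} {v : V} (hv : v ∈ DeloJ α s J) : -v ∈ DeloJ α s J := by
  obtain ⟨g, hg, j, hj, rfl⟩ := hv
  refine ⟨g * s (α j), mul_mem hg (simpleRefl_mem hj), j, hj, ?_⟩
  change _ = g (s (α j) (α j))
  rw [refl_self h (Bsimple h j).ne', map_neg]

lemma rootRefl_mem (h : AffineSetup α δ θ B s) {J : Set ι} {v : V} (hv : v ∈ DeloJ α s J) : s v ∈ WoJ α s J := by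
  obtain ⟨g, hg, j, hj, rfl⟩ := hv
  rw [refl_conj h hg (Bsimple h j).ne']
  exact mul_mem (mul_mem hg (simpleRefl_mem hj)) (inv_mem hg)

/-- Integrality of the Cartan numbers. -/
lemma cartan_int (h : AffineSetup α δ θ B s) {b c : V} (hb : b ∈ Delo α s) (hc : c ∈ Delo α s) :
    ∃ m : ℤ, 2 * B b c / B c c = m := by
  obtain ⟨g, hg, j, hj, rfl⟩ := hc
  have hb' : g⁻¹ b ∈ Delo α s := act_mem (inv_mem hg) hb
  obtain ⟨m, hm⟩ := h.cryst j _ hb'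
  refine ⟨m, ?_⟩
  rw [refl_simple h, ← Int.cast_smul_eq_zsmul ℝ] at hm
  have h1 := sub_right_injective hm
  have h2 := smul_left_injective ℝ (root_ne_zero h (simple_mem (Set.mem_univ j))) h1
  have hbg : b = g (g⁻¹ b) := by
    change b = (g * g⁻¹) b
    simp
  rw [hbg, WoJ_isom h hg, WoJ_isom h hg]
  exact h2

/-- Coordinates of a root of `∘Δ_J`. -/
lemma int_coords (h : AffineSetup α δ θ B s) {J : Set ι} {v : V} (hv : v ∈ DeloJ α s J) :
    ∃ c : ι → ℤ, (∀ i, i ∉ J → c i = 0) ∧ v = ∑ i, (c i : ℝ) • α i := by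
  classical
  obtain ⟨g, hg, j, hj, rfl⟩ := hv
  refine WoJ_induction h (p := fun g => ∃ c : ι → ℤ, (∀ i, i ∉ J → c i = 0) ∧
    g (α j) = ∑ i, (c i : ℝ) • α i) ?_ ?_ hg
  · refine ⟨Pi.single j 1, ?_, ?_⟩
    · intro i hi
      have : i ≠ j := by rintro rfl; exact hi hj
      simp [this]
    · simp [Pi.single_apply]
  · rintro k hk g hg ⟨c, hc, hcv⟩
    obtain ⟨m, hm⟩ := h.cryst k (g (α j)) (DeloJ_sub J ⟨g, hg, j, hj, rfl⟩)
    refine ⟨c - Pi.single k m, ?_, ?_⟩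
    · intro i hi
      have : i ≠ k := by rintro rfl; exact hi hk
      simp [this, hc i hi]
    · change s (α k) (g (α j)) = _
      rw [hm, hcv]
      simp [Pi.single_apply, sub_smul, ← Int.cast_smul_eq_zsmul ℝ]


/-- Coordinate functionals: `d` is the `δ`-coordinate, `c i` the coefficient of `α i`. -/
structure Co (α : ι → V) (δ θ : V) (d : V →ₗ[ℝ] ℝ) (c : ι → V →ₗ[ℝ] ℝ) : Prop where
  dd : d δ = 1
  da : ∀ i, d (α i) = 0
  cs : ∀ i, c i (α i) = 1
  cn : ∀ i j, j ≠ i → c i (α j) = 0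
  cd : ∀ i, c i δ = c i θ

lemma exists_coord (h : AffineSetup α δ θ B s) : ∃ d c, Co α δ θ d c := by
  classical
  have hi : Function.Injective (Finsupp.linearCombination ℝ (alHat α δ θ)) := h.indep
  obtain ⟨L, hL⟩ := LinearMap.exists_leftInverse_of_injective
    (Finsupp.linearCombination ℝ (alHat α δ θ)) (LinearMap.ker_eq_bot.mpr hi)
  have key : ∀ o o', Finsupp.lapply (R := ℝ) o (L (alHat α δ θ o')) = if o' = o then 1 else 0 := by
    intro o o'
    have := LinearMap.congr_fun hL (Finsupp.single o' 1)
    simp only [LinearMap.comp_apply, Finsupp.linearCombination_single, one_smul,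
      LinearMap.id_apply] at this
    simp only [this, Finsupp.lapply_apply, Finsupp.single_apply]
  have hth : Finsupp.lapply (R := ℝ) (none : Option ι) (L θ) = 0 := by
    obtain ⟨c, -, hc⟩ := int_coords h h.theta_high.1
    rw [hc]
    simp only [map_sum, map_smul]
    refine Finset.sum_eq_zero fun i _ => ?_
    have := key none (some i)
    simp only [alHat, Option.elim] at this
    rw [this]; simp
  refine ⟨(Finsupp.lapply none).comp L, fun i => (Finsupp.lapply (some i)).comp L, ?_, ?_, ?_, ?_, ?_⟩
  · have := key none none
    simp only [alHat, Option.elim, map_sub, if_true] at this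
    simp only [LinearMap.comp_apply]
    linarith
  · intro i
    simpa [alHat] using key none (some i)
  · intro i
    simpa [alHat] using key (some i) (some i)
  · intro i j hij
    simpa [alHat, hij] using key (some i) (some j)
  · intro i
    have := key (some i) none
    simp only [alHat, Option.elim, map_sub] at this
    simp only [LinearMap.comp_apply]
    simp only [reduceCtorEq, if_false] at this
    linarith

variable {d : V →ₗ[ℝ] ℝ} {c : ι → V →ₗ[ℝ] ℝ}

lemma Co.sum (k : Co α δ θ d c) (i : ι) (x : ι → ℝ) : c i (∑ j, x j • α j) = x i := by
  rw [map_sum, Finset.sum_eq_single i]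
  · simp [k.cs]
  · intro j _ hj; simp [k.cn i j hj]
  · simp

lemma Co.pos (k : Co α δ θ d c) {v : V} (hv : PosoComb α v) (i : ι) : 0 ≤ c i v := by
  obtain ⟨x, hx, rfl⟩ := hv
  rw [k.sum]; exact hx i

lemma Co.expand (h : AffineSetup α δ θ B s) (k : Co α δ θ d c) {v : V} (hv : v ∈ Delo α s) :
    v = ∑ i, c i v • α i := by
  obtain ⟨x, -, hx⟩ := int_coords h hv
  conv_lhs => rw [hx]
  refine Finset.sum_congr rfl fun i _ => ?_
  conv_rhs => rw [hx, k.sum]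

lemma Co.int (h : AffineSetup α δ θ B s) (k : Co α δ θ d c) {v : V} (hv : v ∈ Delo α s) (i : ι) :
    ∃ m : ℤ, c i v = m := by
  obtain ⟨x, -, hx⟩ := int_coords h hv
  exact ⟨x i, by rw [hx, k.sum i (fun j => (x j : ℝ))]⟩

lemma Co.d_root (h : AffineSetup α δ θ B s) (k : Co α δ θ d c) {v : V} (hv : v ∈ Delo α s) :
    d v = 0 := by
  rw [k.expand h hv]; simp [k.da]

lemma Co.pos_of (h : AffineSetup α δ θ B s) (k : Co α δ θ d c) {v : V} (hv : v ∈ Delo α s)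
    {i : ι} (hi : 0 < c i v) : PosoComb α v := by
  rcases h.base v hv with h1 | h1
  · exact h1.1
  · have := k.pos h1.1 i
    rw [map_neg] at this; linarith

lemma not_both (h : AffineSetup α δ θ B s) {v : V} (hv : v ∈ Delo α s)
    (h1 : PosoComb α v) (h2 : PosoComb α (-v)) : False := by
  rcases h.base v hv with h3 | h3
  · exact h3.2 h2
  · exact h3.2 h1

lemma neg_of_not_pos (h : AffineSetup α δ θ B s) {v : V} (hv : v ∈ Delo α s)
    (h1 : ¬ PosoComb α v) : PosoComb α (-v) := by
  rcases h.base v hv with h3 | h3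
  · exact absurd h3.1 h1
  · exact h3.1

lemma poso_add {u v : V} (hu : PosoComb α u) (hv : PosoComb α v) : PosoComb α (u + v) := by
  obtain ⟨x, hx, rfl⟩ := hu
  obtain ⟨y, hy, rfl⟩ := hv
  exact ⟨x + y, fun i => add_nonneg (hx i) (hy i), by simp [add_smul, Finset.sum_add_distrib]⟩

lemma simple_pos (i : ι) : PosoComb α (α i) := by
  classical
  refine ⟨Pi.single i 1, fun j => ?_, by simp [Pi.single_apply]⟩
  rw [Pi.single_apply]; split_ifs <;> norm_num

/-- A positive root other than `α j` stays positive under `s_j`. -/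
lemma refl_pos (h : AffineSetup α δ θ B s) {v : V} (hv : v ∈ Delo α s) (hp : PosoComb α v)
    {j : ι} (hj : v ≠ α j) : PosoComb α (s (α j) v) := by
  obtain ⟨d, c, k⟩ := exists_coord h
  have hsv : s (α j) v ∈ Delo α s := act_mem (simpleRefl_mem (Set.mem_univ j)) hv
  by_cases hc : ∃ i, i ≠ j ∧ c i v ≠ 0
  · obtain ⟨i, hij, hi⟩ := hc
    refine k.pos_of h hsv (i := i) ?_
    rw [refl_simple h, map_sub, map_smul, k.cn i j hij.symm]
    have := lt_of_le_of_ne (k.pos hp i) hi.symm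
    simpa using this
  · push Not at hc
    exfalso
    have hv1 : v = c j v • α j := by
      conv_lhs => rw [k.expand h hv]
      refine Finset.sum_eq_single j ?_ (by simp)
      intro i _ hi
      rw [hc i hi, zero_smul]
    obtain ⟨g, hg, i, _, hgi⟩ := id hv
    have hr : g⁻¹ (α j) ∈ Delo α s := act_mem (inv_mem hg) (simple_mem (Set.mem_univ j))
    have h1 : α i = c j v • g⁻¹ (α j) := by
      rw [← map_smul, ← hv1, hgi]
      change _ = (g⁻¹ * g) (α i)
      simp
    obtain ⟨m, hm⟩ := k.int h hv j
    obtain ⟨n, hn⟩ := k.int h hr i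
    have h2 : (1 : ℝ) = m * n := by
      rw [← hm, ← hn, ← smul_eq_mul, ← map_smul, ← h1, k.cs]
    have h3 : m * n = 1 := by exact_mod_cast h2.symm
    have h4 : 0 ≤ m := by
      have := k.pos hp j
      rw [hm] at this; exact_mod_cast this
    have h5 : m = 1 := by
      rcases Int.eq_one_or_neg_one_of_mul_eq_one h3 with h | h <;> omega
    apply hj
    rw [hv1, hm, h5]; simp

/-- A positive root of `∘Δ_J` is a sum of simple roots from `J`. -/
lemma pos_mem_closure (h : AffineSetup α δ θ B s) {J : Set ι} {v : V} (hv : v ∈ DeloJ α s J)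
    (hp : PosoComb α v) : v ∈ AddSubmonoid.closure (α '' J) := by
  obtain ⟨d, c, k⟩ := exists_coord h
  obtain ⟨x, hx, hxv⟩ := int_coords h hv
  have hx0 : ∀ i, 0 ≤ x i := by
    intro i
    have := k.pos hp i
    rw [hxv, k.sum i (fun j => (x j : ℝ))] at this
    exact_mod_cast this
  rw [hxv]
  refine AddSubmonoid.sum_mem _ fun i _ => ?_
  by_cases hi : i ∈ J
  · obtain ⟨n, hn⟩ := Int.eq_ofNat_of_zero_le (hx0 i)
    rw [hn]
    simp only [Int.cast_natCast, Nat.cast_smul_eq_nsmul]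
    exact nsmul_mem (AddSubmonoid.subset_closure (Set.mem_image_of_mem α hi)) n
  · simp [hx i hi]

/-- Two roots at an obtuse angle: the sum is zero or a root. -/
lemma add_mem (h : AffineSetup α δ θ B s) {J : Set ι} {b g : V} (hb : b ∈ DeloJ α s J)
    (hg : g ∈ DeloJ α s J) (hneg : B b g < 0) : b + g = 0 ∨ b + g ∈ DeloJ α s J := by
  have hbD := DeloJ_sub J hb
  have hgD := DeloJ_sub J hg
  have hbb := h.Bpos _ hbD
  have hgg := h.Bpos _ hgD
  obtain ⟨m, hm⟩ := cartan_int h hbD hgD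
  obtain ⟨n, hn⟩ := cartan_int h hgD hbD
  have hsg : ∀ v, s g v = v - (2 * B v g / B g g) • g := h.refl_def g hgg.ne'
  have hsb : ∀ v, s b v = v - (2 * B v b / B b b) • b := h.refl_def b hbb.ne'
  have hsgb : s g b = b - (m : ℝ) • g := by rw [hsg, hm]
  have hsbg : s b g = g - (n : ℝ) • b := by rw [hsb, hn]
  have hm0 : m < 0 := by
    have : (m : ℝ) < 0 := by rw [← hm]; exact div_neg_of_neg_of_pos (by linarith) hgg
    exact_mod_cast this
  have hn0 : n < 0 := by
    have : (n : ℝ) < 0 := by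
      rw [← hn, h.Bsymm]; exact div_neg_of_neg_of_pos (by linarith) hbb
    exact_mod_cast this
  by_cases hm1 : m = -1
  · right
    have : s g b ∈ DeloJ α s J := act_mem (rootRefl_mem h hg) hb
    rw [hsgb, hm1] at this
    simpa using this
  by_cases hn1 : n = -1
  · right
    have : s b g ∈ DeloJ α s J := act_mem (rootRefl_mem h hb) hg
    rw [hsbg, hn1] at this
    simpa [add_comm] using this
  left
  have hm2 : m ≤ -2 := by omega
  have hn2 : n ≤ -2 := by omega
  by_cases hli : LinearIndependent ℝ ![b, g]
  · exfalso
    have hi : Function.Injective (Finsupp.linearCombination ℝ ![b, g]) := hli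
    obtain ⟨L, hL⟩ := LinearMap.exists_leftInverse_of_injective
      (Finsupp.linearCombination ℝ ![b, g]) (LinearMap.ker_eq_bot.mpr hi)
    have key : ∀ i, L (![b, g] i) = Finsupp.single i 1 := by
      intro i
      have := LinearMap.congr_fun hL (Finsupp.single i 1)
      simpa using this
    have hLb : L b = Finsupp.single 0 1 := key 0
    have hLg : L g = Finsupp.single 1 1 := key 1
    obtain ⟨φ, hφ⟩ : ∃ φ : V →ₗ[ℝ] ℝ, φ b = 1 ∧ φ g = 1 :=
      ⟨(Finsupp.linearCombination ℝ (fun _ : Fin 2 => (1 : ℝ))).comp L, by simp [hLb],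
        by simp [hLg]⟩
    let S : Set V := {v ∈ Delo α s | ∃ x y : ℤ, 0 ≤ x ∧ x < y ∧ v = (x : ℝ) • b + (y : ℝ) • g}
    have hSf : S.Finite := h.finite.subset fun v hv => hv.1
    have hSn : S.Nonempty := ⟨g, hgD, 0, 1, by norm_num, by norm_num, by simp⟩
    obtain ⟨v, ⟨hvD, x, y, hx, hxy, hv⟩, hmax⟩ := Set.exists_max_image S φ hSf hSn
    have e1 : s b v = ((-n * y - x : ℤ) : ℝ) • b + (y : ℝ) • g := by
      rw [hv, map_add, map_smul, map_smul, refl_self h hbb.ne', hsbg]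
      push_cast; module
    have e2 : s g (s b v) = ((-n * y - x : ℤ) : ℝ) • b +
        ((-m * (-n * y - x) - y : ℤ) : ℝ) • g := by
      rw [e1, map_add, map_smul, map_smul, refl_self h hgg.ne', hsgb]
      push_cast; module
    have hx' : y < -n * y - x := by nlinarith
    have hy' : -n * y - x < -m * (-n * y - x) - y := by nlinarith
    have hmem : s g (s b v) ∈ S :=
      ⟨act_mem (rootRefl_mem h hgD) (act_mem (rootRefl_mem h hbD) hvD), _, _, by omega, hy', e2⟩
    have := hmax _ hmem
    rw [e2, hv] at this
    simp only [map_add, map_smul, hφ.1, hφ.2, smul_eq_mul, mul_one] at this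
    have h' : (-n * y - x) + (-m * (-n * y - x) - y) ≤ x + y := by exact_mod_cast this
    omega
  · have hb0 : b ≠ 0 := root_ne_zero h hbD
    rw [LinearIndependent.pair_iff' hb0] at hli
    push Not at hli
    obtain ⟨t, ht⟩ := hli
    have e1 : (n : ℝ) = 2 * t := by
      rw [← hn, ← ht]; simp; field_simp
    have ht0 : t ≠ 0 := by
      rintro rfl
      simp at e1; omega
    have e2 : (m : ℝ) * t = 2 := by
      rw [← hm, ← ht]; simp; field_simp
    have h1 : (n : ℝ) ≤ -2 := by exact_mod_cast hn2
    have h2 : (m : ℝ) ≤ -2 := by exact_mod_cast hm2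
    have : t = -1 := by nlinarith
    rw [← ht, this]; simp

/-- The additive monoid generated by `Q` contains no nontrivial inverse pair. -/
def Salient (Q : Set V) : Prop :=
  ∀ x ∈ AddSubmonoid.closure Q, -x ∈ AddSubmonoid.closure Q → x = 0

lemma no_zero_sum (h : AffineSetup α δ θ B s) {J : Set ι} {P : Set V} (hP : P ⊆ DeloJ α s J)
    (h0 : ∀ x ∈ P, ∀ y ∈ P, x + y ≠ 0)
    (hc : ∀ x ∈ P, ∀ y ∈ P, x + y ∈ DeloJ α s J → x + y ∈ P) (n : ℕ) :
    ∀ m : Multiset V, Multiset.card m = n → (∀ x ∈ m, x ∈ P) → m.sum = 0 → m = 0 := by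
  induction n with
  | zero => intro m hm _ _; exact Multiset.card_eq_zero.mp hm
  | succ n ih =>
    intro m hm hmP hsum
    exfalso
    obtain ⟨b, t, rfl⟩ : ∃ b t, m = b ::ₘ t := by
      obtain ⟨b, hb⟩ := Multiset.card_pos_iff_exists_mem.mp (by omega : 0 < Multiset.card m)
      exact ⟨b, Multiset.exists_cons_of_mem hb⟩
    have hbP : b ∈ P := hmP b (Multiset.mem_cons_self b t)
    have hbb := h.Bpos b (DeloJ_sub J (hP hbP))
    rw [Multiset.sum_cons] at hsum
    obtain ⟨g, hg, hbg⟩ : ∃ g ∈ t, B b g < 0 := by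
      by_contra hcon
      push Not at hcon
      have h1 : 0 ≤ (t.map (B b)).sum := by
        apply Multiset.sum_nonneg
        intro x hx
        obtain ⟨g, hg, rfl⟩ := Multiset.mem_map.mp hx
        exact hcon g hg
      have h2 : B b t.sum = (t.map (B b)).sum := map_multiset_sum (B b) t
      have h3 : B b (b + t.sum) = 0 := by rw [hsum, map_zero]
      rw [map_add] at h3
      linarith
    obtain ⟨t', rfl⟩ := Multiset.exists_cons_of_mem hg
    have hgP : g ∈ P := hmP g (by simp)
    have hbgP : b + g ∈ P := by
      rcases add_mem h (hP hbP) (hP hgP) hbg with h1 | h1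
      · exact absurd h1 (h0 b hbP g hgP)
      · exact hc b hbP g hgP h1
    have := ih ((b + g) ::ₘ t') (by simpa using hm) (by
      intro x hx
      rcases Multiset.mem_cons.mp hx with rfl | hx
      · exact hbgP
      · exact hmP x (by simp [hx])) (by
      rw [Multiset.sum_cons]; rw [Multiset.sum_cons] at hsum; rw [← hsum]; abel)
    simp at this

lemma salient_of (h : AffineSetup α δ θ B s) {J : Set ι} {P : Set V} (hP : P ⊆ DeloJ α s J)
    (h0 : ∀ x ∈ P, ∀ y ∈ P, x + y ≠ 0)
    (hc : ∀ x ∈ P, ∀ y ∈ P, x + y ∈ DeloJ α s J → x + y ∈ P) : Salient P := by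
  intro x hx hx'
  obtain ⟨m, hm, hmx⟩ := AddSubmonoid.exists_multiset_of_mem_closure hx
  obtain ⟨m', hm', hmx'⟩ := AddSubmonoid.exists_multiset_of_mem_closure hx'
  have h1 := no_zero_sum h hP h0 hc _ (m + m') rfl (by
    intro y hy
    rcases Multiset.mem_add.mp hy with hy | hy
    · exact hm y hy
    · exact hm' y hy) (by rw [Multiset.sum_add, hmx, hmx', add_neg_cancel])
  have h2 : m = 0 := (add_eq_zero.mp h1).1
  rw [← hmx, h2, Multiset.sum_zero]

lemma neg_mul_mem {Q : Set V} (hQ : Salient Q) {b : V} (hb : ¬ Salient (insert b Q)) :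
    ∃ n : ℕ, 0 < n ∧ -(n • b) ∈ AddSubmonoid.closure Q := by
  unfold Salient at hb
  push Not at hb
  obtain ⟨x, hx, hx', hx0⟩ := hb
  rw [Set.insert_eq, AddSubmonoid.closure_union, AddSubmonoid.mem_sup] at hx hx'
  obtain ⟨y, hy, z, hz, hyz⟩ := hx
  obtain ⟨y', hy', z', hz', hyz'⟩ := hx'
  obtain ⟨n, rfl⟩ := AddSubmonoid.mem_closure_singleton.mp hy
  obtain ⟨n', rfl⟩ := AddSubmonoid.mem_closure_singleton.mp hy'
  refine ⟨n + n', ?_, ?_⟩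
  · by_contra h0
    have hn : n = 0 := by omega
    have hn' : n' = 0 := by omega
    subst hn hn'
    simp only [zero_smul, zero_add] at hyz hyz'
    exact hx0 (hQ x (hyz ▸ hz) (hyz' ▸ hz'))
  · have : -((n + n') • b) = z + z' := by
      have h1 : (n • b + z) + (n' • b + z') = 0 := by rw [hyz, hyz', add_neg_cancel]
      rw [neg_eq_iff_add_eq_zero, ← h1, add_smul]; abel
    rw [this]
    exact AddSubmonoid.add_mem _ hz hz'

lemma exists_total (h : AffineSetup α δ θ B s) {J : Set ι} {P : Set V} (hP : P ⊆ DeloJ α s J)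
    (hs : Salient P) : ∃ Q, P ⊆ Q ∧ Q ⊆ DeloJ α s J ∧ Salient Q ∧
      ∀ b ∈ DeloJ α s J, b ∈ Q ∨ -b ∈ Q := by
  have hfin : {Q : Set V | Q ⊆ DeloJ α s J ∧ Salient Q}.Finite :=
    ((h.finite.subset (DeloJ_sub J)).finite_subsets).subset fun Q hQ => hQ.1
  obtain ⟨Q, hPQ, hQ⟩ := hfin.exists_le_maximal (a := P) ⟨hP, hs⟩
  refine ⟨Q, hPQ, hQ.prop.1, hQ.prop.2, ?_⟩
  intro b hb
  by_contra hcon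
  push Not at hcon
  have aux : ∀ a ∈ DeloJ α s J, a ∉ Q → ¬ Salient (insert a Q) := by
    intro a ha haQ hsal
    have := hQ.le_of_ge (y := insert a Q) ⟨Set.insert_subset ha hQ.prop.1, hsal⟩
      (Set.subset_insert a Q)
    exact haQ (this (Set.mem_insert a Q))
  obtain ⟨n, hn, h1⟩ := neg_mul_mem hQ.prop.2 (aux b hb hcon.1)
  obtain ⟨m, hm, h2⟩ := neg_mul_mem hQ.prop.2 (aux (-b) (neg_mem h hb) hcon.2)
  have h3 : (m * n) • b ∈ AddSubmonoid.closure Q := by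
    have := nsmul_mem h2 n
    rw [smul_neg, smul_neg, smul_neg, neg_neg, ← mul_smul] at this
    rwa [mul_comm]
  have h4 : -((m * n) • b) ∈ AddSubmonoid.closure Q := by
    have := nsmul_mem h1 m
    rwa [smul_neg, ← mul_smul] at this
  have h5 := hQ.prop.2 _ h3 h4
  rw [← Nat.cast_smul_eq_nsmul ℝ] at h5
  rcases smul_eq_zero.mp h5 with h6 | h6
  · have : 0 < m * n := Nat.mul_pos hm hn
    have h7 : m * n = 0 := by exact_mod_cast h6
    omega
  · exact root_ne_zero h (DeloJ_sub J hb) h6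

/-- A salient set of roots lies in `w ∘Δ_{J-}` for some `w`. -/
lemma exists_w (h : AffineSetup α δ θ B s) {J : Set ι} {P : Set V} (hP : P ⊆ DeloJ α s J)
    (hs : Salient P) : ∃ w ∈ WoJ α s J, P ⊆ ⇑w '' DeloKJneg α s J ∅ := by
  obtain ⟨Q, hPQ, hQJ, hQs, hQt⟩ := exists_total h hP hs
  have hQn : ∀ b ∈ Q, -b ∉ Q := by
    intro b hb hb'
    exact root_ne_zero h (DeloJ_sub J (hQJ hb))
      (hQs b (AddSubmonoid.subset_closure hb) (AddSubmonoid.subset_closure hb'))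
  let N : (V ≃ₗ[ℝ] V) → Set V := fun w => {b ∈ DeloJ α s J | PosoComb α b ∧ w b ∈ Q}
  have hNf : ∀ w, (N w).Finite := fun w =>
    (h.finite.subset (DeloJ_sub J)).subset fun b hb => hb.1
  obtain ⟨w, hw, hmin⟩ : ∃ w ∈ WoJ α s J, ∀ w' ∈ WoJ α s J, (N w).ncard ≤ (N w').ncard := by
    have hne : ((fun w => (N w).ncard) '' (WoJ α s J : Set (V ≃ₗ[ℝ] V))).Nonempty :=
      ⟨_, 1, one_mem _, rfl⟩
    obtain ⟨w, hw, hwm⟩ := Nat.sInf_mem hne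
    refine ⟨w, hw, fun w' hw' => ?_⟩
    simp only at hwm
    rw [hwm]
    exact Nat.sInf_le ⟨w', hw', rfl⟩
  have hsimple : ∀ j ∈ J, w (α j) ∉ Q := by
    intro j hj hjQ
    have hlt : (N (w * s (α j))).ncard < (N w).ncard := by
      have hinj : Function.Injective (s (α j)) := (s (α j)).injective
      rw [← Set.ncard_image_of_injective _ hinj]
      apply Set.ncard_lt_ncard _ (hNf w)
      rw [Set.ssubset_iff_of_subset]
      · refine ⟨α j, ⟨simple_mem hj, simple_pos j, hjQ⟩, ?_⟩
        rintro ⟨b, ⟨hb, hbp, hbQ⟩, hbj⟩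
        have : b = -α j := by
          rw [← refl_self h (Bsimple h j).ne', ← refl_invol h (Bsimple h j).ne' b, hbj]
        rw [this] at hbp
        exact not_both h (simple_mem (Set.mem_univ j)) (simple_pos j) hbp
      · rintro _ ⟨b, ⟨hb, hbp, hbQ⟩, rfl⟩
        refine ⟨act_mem (simpleRefl_mem hj) hb, refl_pos h (DeloJ_sub J hb) hbp ?_, hbQ⟩
        rintro rfl
        change w (s (α j) (α j)) ∈ Q at hbQ
        rw [refl_self h (Bsimple h j).ne', map_neg] at hbQ
        exact hQn _ hjQ hbQ
    have := hmin (w * s (α j)) (mul_mem hw (simpleRefl_mem hj))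
    omega
  have hneg : ∀ b ∈ AddSubmonoid.closure (α '' J), -(w b) ∈ AddSubmonoid.closure Q := by
    intro b hb
    induction hb using AddSubmonoid.closure_induction with
    | mem x hx =>
      obtain ⟨j, hj, rfl⟩ := hx
      refine AddSubmonoid.subset_closure ?_
      exact (hQt _ (act_mem hw (simple_mem hj))).resolve_left (hsimple j hj)
    | zero => simp
    | add x y _ _ hx hy =>
      have := AddSubmonoid.add_mem _ hx hy
      rwa [← neg_add, ← map_add] at this
  refine ⟨w, hw, fun e he => ?_⟩
  have hwe : w (w⁻¹ e) = e := by
    change (w * w⁻¹) e = e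
    simp
  have hmem : w⁻¹ e ∈ DeloJ α s J := act_mem (inv_mem hw) (hP he)
  refine ⟨w⁻¹ e, ⟨⟨hmem, ?_⟩, ?_⟩, hwe⟩
  · rintro ⟨_, _, j, hj, _⟩
    exact hj
  · refine neg_of_not_pos h (DeloJ_sub J hmem) fun hp => ?_
    have h1 := hneg _ (pos_mem_closure h hmem hp)
    rw [hwe] at h1
    exact root_ne_zero h (DeloJ_sub J (hP he))
      (hQs e (AddSubmonoid.subset_closure (hPQ he)) h1)

/-- Exchange. -/
lemma exchange (h : AffineSetup α δ θ B s) (j : ι) (l : List ι) :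
    PosoComb α ((l.map (fun i => s (α i))).prod (α j)) ∨
    ∃ l' : List ι, l'.length + 1 = l.length ∧ (∀ i ∈ l', i ∈ l ∨ i = j) ∧
      (l.map (fun i => s (α i))).prod * s (α j) = (l'.map (fun i => s (α i))).prod := by
  induction l with
  | nil => left; simpa using simple_pos j
  | cons a t ih =>
    set T := (t.map (fun i => s (α i))).prod with hT
    have hTW : T ∈ WoJ α s Set.univ := by
      apply Subgroup.list_prod_mem
      intro x hx
      obtain ⟨i, _, rfl⟩ := List.mem_map.mp hx
      exact simpleRefl_mem (Set.mem_univ i)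
    rcases ih with ih | ⟨l', hl, hli, hp⟩
    · by_cases hTa : T (α j) = α a
      · right
        refine ⟨t, by simp, fun i hi => Or.inl (List.mem_cons_of_mem _ hi), ?_⟩
        have hc := refl_conj h hTW (Bsimple h j).ne'
        rw [hTa] at hc
        rw [List.map_cons, List.prod_cons, ← hT, hc]
        simp only [inv_mul_cancel_right]
        rw [mul_assoc, refl_mul_self h (Bsimple h j).ne', mul_one]
      · left
        rw [List.map_cons, List.prod_cons, ← hT]
        exact refl_pos h (act_mem hTW (simple_mem (Set.mem_univ j))) ih hTa
    · right
      refine ⟨a :: l', by simp [hl], ?_, ?_⟩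
      · intro i hi
        rcases List.mem_cons.mp hi with rfl | hi
        · simp
        · rcases hli i hi with h1 | h1
          · left; simp [h1]
          · right; exact h1
      · rw [List.map_cons, List.prod_cons, ← hT, mul_assoc, hp, List.map_cons, List.prod_cons]

/-- An element of `∘W_J` preserving positivity on `∘Π_J` is trivial. -/
lemma eq_one (h : AffineSetup α δ θ B s) {J : Set ι} {g : V ≃ₗ[ℝ] V} (hg : g ∈ WoJ α s J)
    (hp : ∀ j ∈ J, PosoComb α (g (α j))) : g = 1 := by
  have hex : ∃ n : ℕ, ∃ l : List ι, l.length = n ∧ (∀ i ∈ l, i ∈ J) ∧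
      (l.map (fun i => s (α i))).prod = g := by
    refine WoJ_induction h (p := fun g => ∃ n : ℕ, ∃ l : List ι, l.length = n ∧ (∀ i ∈ l, i ∈ J) ∧
      (l.map (fun i => s (α i))).prod = g) ⟨0, [], rfl, by simp, by simp⟩ ?_ hg
    rintro j hj g _ ⟨n, l, _, hl, rfl⟩
    exact ⟨_, j :: l, rfl, by simpa using ⟨hj, hl⟩, by simp⟩
  classical
  obtain ⟨l, hl, hlJ, hlg⟩ := Nat.find_spec hex
  rcases List.eq_nil_or_concat' l with rfl | ⟨t, j, rfl⟩
  · simpa using hlg.symm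
  exfalso
  have hjJ : j ∈ J := hlJ j (by simp)
  set T := (t.map (fun i => s (α i))).prod with hT
  have hgT : g = T * s (α j) := by rw [← hlg]; simp [hT]
  have hTW : T ∈ WoJ α s Set.univ := by
    apply Subgroup.list_prod_mem
    intro x hx
    obtain ⟨i, _, rfl⟩ := List.mem_map.mp hx
    exact simpleRefl_mem (Set.mem_univ i)
  rcases exchange h j t with h1 | ⟨l', hl', hli, hpr⟩
  · rw [← hT] at h1
    have h2 := hp j hjJ
    rw [hgT] at h2
    change PosoComb α (T (s (α j) (α j))) at h2
    rw [refl_self h (Bsimple h j).ne', map_neg] at h2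
    exact not_both h (act_mem hTW (simple_mem (Set.mem_univ j))) h1 h2
  · rw [← hT] at hpr
    have := Nat.find_min' hex ⟨l', rfl, fun i hi => by
      rcases hli i hi with h3 | rfl
      · exact hlJ i (by simp [h3])
      · exact hjJ, by rw [hgT, hpr]⟩
    simp at hl
    omega

/-- All coefficients of `θ` are positive. -/
lemma theta_full (h : AffineSetup α δ θ B s) (k : Co α δ θ d c) (i : ι) : 0 < c i θ := by
  obtain ⟨hθ, hθp, hθm⟩ := h.theta_high
  have hoff : ∀ i j, i ≠ j → B (α i) (α j) ≤ 0 := by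
    intro i j hij
    have hr := refl_pos h (simple_mem (Set.mem_univ i)) (simple_pos i) (j := j) (by
      intro he
      have h1 := k.cs i
      rw [he, k.cn i j hij.symm] at h1
      exact zero_ne_one h1)
    have h1 := k.pos hr j
    rw [refl_simple h, map_sub, map_smul, k.cs, k.cn j i hij] at h1
    simp only [smul_eq_mul, mul_one, zero_sub, Left.nonneg_neg_iff] at h1
    by_contra hcon
    push Not at hcon
    have : 0 < 2 * B (α i) (α j) / B (α j) (α j) := by
      have := Bsimple h j
      positivity
    linarith
  have hdom : ∀ j, 0 ≤ B θ (α j) := by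
    intro j
    by_contra hcon
    push Not at hcon
    rcases add_mem h hθ (simple_mem (Set.mem_univ j)) hcon with h1 | h1
    · have : θ = -α j := eq_neg_of_add_eq_zero_left h1
      rw [this] at hθp
      exact not_both h (simple_mem (Set.mem_univ j)) (simple_pos j) hθp
    · exact hθm j (Set.mem_univ j) h1
  have hA := h.irred {i | 0 < c i θ} (by
    intro i hi j hj
    have hj0 : c j θ = 0 := le_antisymm (not_lt.mp hj) (k.pos hθp j)
    have hsum : B θ (α j) = ∑ i, c i θ * B (α i) (α j) := by
      conv_lhs => rw [k.expand h hθ]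
      simp
    have hterm : ∀ i ∈ Finset.univ, c i θ * B (α i) (α j) ≤ 0 := by
      intro i _
      by_cases hij : i = j
      · rw [hij, hj0, zero_mul]
      · exact mul_nonpos_of_nonneg_of_nonpos (k.pos hθp i) (hoff i j hij)
    have hz : ∑ i, c i θ * B (α i) (α j) = 0 :=
      le_antisymm (Finset.sum_nonpos hterm) (hsum ▸ hdom j)
    have := (Finset.sum_eq_zero_iff_of_nonpos hterm).mp hz i (Finset.mem_univ i)
    have hB : B (α i) (α j) = 0 := (mul_eq_zero.mp this).resolve_left (ne_of_gt hi)
    rw [refl_simple h, h.Bsymm, hB]; simp)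
  rcases hA with hA | hA
  · exfalso
    apply root_ne_zero h hθ
    rw [k.expand h hθ]
    refine Finset.sum_eq_zero fun i _ => ?_
    have : ¬ (0 < c i θ) := fun hi => by
      have : i ∈ {i | 0 < c i θ} := hi
      rw [hA] at this; exact this
    rw [le_antisymm (not_lt.mp this) (k.pos hθp i), zero_smul]
  · have : i ∈ {i | 0 < c i θ} := by rw [hA]; trivial
    exact this

lemma poscomb_add {u v : V} (hu : PosComb α δ θ u) (hv : PosComb α δ θ v) :
    PosComb α δ θ (u + v) := by
  obtain ⟨x, hx, rfl⟩ := hu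
  obtain ⟨y, hy, rfl⟩ := hv
  exact ⟨x + y, fun i => add_nonneg (hx i) (hy i), by simp only [Pi.add_apply, add_smul, Finset.sum_add_distrib]⟩

lemma poscomb_antisymm (h : AffineSetup α δ θ B s) {u : V} (hu : PosComb α δ θ u)
    (hv : PosComb α δ θ (-u)) : u = 0 := by
  obtain ⟨x, hx, hxu⟩ := hu
  obtain ⟨y, hy, hyu⟩ := hv
  have hz : ∑ o, (x o + y o) • alHat α δ θ o = 0 := by
    simp only [add_smul, Finset.sum_add_distrib]
    rw [← hxu, ← hyu, add_neg_cancel]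
  have h1 := Fintype.linearIndependent_iff.mp h.indep _ hz
  rw [hxu]
  refine Finset.sum_eq_zero fun o _ => ?_
  have : x o = 0 := by linarith [h1 o, hx o, hy o]
  rw [this, zero_smul]

/-- `⟨ε⟩` is nonempty for every root `ε`. -/
lemma brkt_nonempty (h : AffineSetup α δ θ B s) {e : V} (he : e ∈ Delo α s) :
    (brkt α δ θ s e).Nonempty := by
  obtain ⟨d, c, k⟩ := exists_coord h
  obtain ⟨m, hm⟩ : ∃ m : ℕ, ∀ i, 0 ≤ m * c i θ + c i e := by
    have : ∀ i, ∃ m : ℕ, -c i e / c i θ ≤ m := fun i => exists_nat_ge _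
    choose m hm using this
    refine ⟨∑ i, m i, fun i => ?_⟩
    have h1 : (m i : ℝ) ≤ ((∑ i, m i : ℕ) : ℝ) := by
      exact_mod_cast Finset.single_le_sum (f := m) (fun _ _ => Nat.zero_le _) (Finset.mem_univ i)
    have h2 := (hm i).trans h1
    rw [div_le_iff₀ (theta_full h k i)] at h2
    linarith
  refine ⟨(m : ℤ) • δ + e, ⟨m, rfl⟩, ⟨m, e, he, rfl⟩, Or.inl ⟨m, e, he, rfl⟩, ?_⟩
  refine ⟨fun o => o.elim (m : ℝ) (fun i => m * c i θ + c i e), ?_, ?_⟩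
  · rintro (_ | i)
    · simp
    · exact hm i
  · rw [Fintype.sum_option]
    simp only [Option.elim, alHat, add_smul, Finset.sum_add_distrib, mul_smul]
    rw [← Finset.smul_sum, ← k.expand h h.theta_high.1, ← k.expand h he,
      ← Int.cast_smul_eq_zsmul ℝ]
    push_cast
    module

/-- The finite part of a vector. -/
noncomputable def fp (d : V →ₗ[ℝ] ℝ) (δ : V) : V →ₗ[ℝ] V := LinearMap.id - d.smulRight δ

lemma fp_apply (d : V →ₗ[ℝ] ℝ) (δ v : V) : fp d δ v = v - d v • δ := rfl

lemma fp_real (h : AffineSetup α δ θ B s) (k : Co α δ θ d c) {e : V} (he : e ∈ Delo α s) (m : ℤ) :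
    fp d δ (m • δ + e) = e := by
  rw [fp_apply, ← Int.cast_smul_eq_zsmul ℝ, map_add, map_smul, k.dd, k.d_root h he]
  simp

lemma fp_imag (k : Co α δ θ d c) (m : ℤ) : fp d δ (m • δ) = 0 := by
  rw [fp_apply, ← Int.cast_smul_eq_zsmul ℝ, map_smul, k.dd]
  simp

lemma fp_rePos (h : AffineSetup α δ θ B s) (k : Co α δ θ d c) {x : V}
    (hx : x ∈ DelRePos α δ θ s) : fp d δ x ∈ Delo α s := by
  obtain ⟨m, e, he, rfl⟩ := hx.1
  rwa [fp_real h k he]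

lemma fp_brSet (h : AffineSetup α δ θ B s) (k : Co α δ θ d c) {P : Set V} (hP : P ⊆ Delo α s)
    {x : V} (hx : x ∈ brSet α δ θ s P) :
    fp d δ x ∈ P ∧ x ∈ brkt α δ θ s (fp d δ x) := by
  simp only [brSet, Set.mem_iUnion] at hx
  obtain ⟨e, he, hxe⟩ := hx
  obtain ⟨m, hm⟩ := hxe.1
  have : fp d δ x = e := by rw [hm, fp_real h k (hP he)]
  rw [this]
  exact ⟨he, hxe⟩

lemma mem_brSet {P : Set V} {x e : V} (he : e ∈ P) (hx : x ∈ brkt α δ θ s e) :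
    x ∈ brSet α δ θ s P := by
  simp only [brSet, Set.mem_iUnion]
  exact ⟨e, he, hx⟩

/-- Elements of `Δ_{J+}` are either real or imaginary. -/
lemma fp_DelJPosB (h : AffineSetup α δ θ B s) (k : Co α δ θ d c) {J : Set ι} {x : V}
    (hx : x ∈ DelJPosB α δ θ s J) :
    (fp d δ x ∈ DeloJ α s J ∧ x ∈ brkt α δ θ s (fp d δ x)) ∨ fp d δ x = 0 := by
  rcases hx with hx | ⟨m, _, rfl⟩
  · exact Or.inl (fp_brSet h k (DeloJ_sub J) hx)
  · right; exact fp_imag k m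

lemma mem_brSet_of_fp (h : AffineSetup α δ θ B s) (k : Co α δ θ d c) {J : Set ι} {P : Set V}
    (hP : P ⊆ Delo α s) {x : V} (hx : x ∈ DelJPosB α δ θ s J) (hxP : fp d δ x ∈ P) :
    x ∈ brSet α δ θ s P := by
  rcases fp_DelJPosB h k hx with h1 | h1
  · exact mem_brSet hxP h1.2
  · rw [h1] at hxP
    exact absurd rfl (root_ne_zero h (hP hxP))

lemma mem_Nw {J : Set ι} {w : V ≃ₗ[ℝ] V} (hw : w ∈ WoJ α s J) {y : V} :
    y ∈ ⇑w '' DeloKJneg α s J ∅ ↔ y ∈ DeloJ α s J ∧ PosoComb α (-(w⁻¹ y)) := by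
  have hwy : w (w⁻¹ y) = y := by
    change (w * w⁻¹) y = y
    simp
  constructor
  · rintro ⟨e, ⟨⟨he, _⟩, hp⟩, rfl⟩
    refine ⟨act_mem hw he, ?_⟩
    have : w⁻¹ (w e) = e := by
      change (w⁻¹ * w) e = e
      simp
    rw [this]; exact hp
  · rintro ⟨hy, hp⟩
    refine ⟨w⁻¹ y, ⟨⟨act_mem (inv_mem hw) hy, ?_⟩, hp⟩, hwy⟩
    rintro ⟨_, _, j, hj, _⟩
    exact hj

lemma Nw_sub {J : Set ι} {w : V ≃ₗ[ℝ] V} (hw : w ∈ WoJ α s J) :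
    ⇑w '' DeloKJneg α s J ∅ ⊆ Delo α s := fun _ hy => DeloJ_sub J ((mem_Nw hw).mp hy).1

lemma DKJm_biconvex (h : AffineSetup α δ θ B s) {J : Set ι} {w : V ≃ₗ[ℝ] V}
    (hw : w ∈ WoJ α s J) :
    RealBiconvexIn α δ θ s (DelJPosB α δ θ s J) (DKJm α δ θ s J ∅ w) := by
  obtain ⟨d, c, k⟩ := exists_coord h
  have hsub : DKJm α δ θ s J ∅ w ⊆ DelJPosB α δ θ s J := by
    intro x hx
    obtain ⟨h1, h2⟩ := fp_brSet h k (Nw_sub hw) hx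
    exact Or.inl (mem_brSet ((mem_Nw hw).mp h1).1 h2)
  refine ⟨⟨⟨hsub, ?_⟩, ⟨Set.sdiff_subset, ?_⟩⟩, ?_⟩
  · intro x hx y hy hxy
    obtain ⟨hx1, hx2⟩ := (mem_Nw hw).mp (fp_brSet h k (Nw_sub hw) hx).1
    obtain ⟨hy1, hy2⟩ := (mem_Nw hw).mp (fp_brSet h k (Nw_sub hw) hy).1
    rcases fp_DelJPosB h k hxy with h1 | h1
    · refine mem_brSet_of_fp h k (Nw_sub hw) hxy ((mem_Nw hw).mpr ⟨h1.1, ?_⟩)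
      rw [map_add, map_add, neg_add]
      exact poso_add hx2 hy2
    · exfalso
      rw [map_add] at h1
      have h3 : fp d δ y = -fp d δ x := eq_neg_of_add_eq_zero_right h1
      rw [h3, map_neg] at hy2
      exact not_both h (DeloJ_sub J (neg_mem h (act_mem (inv_mem hw) hx1))) hx2 hy2
  · rintro x ⟨hxA, hx⟩ y ⟨hyA, hy⟩ hxy
    refine ⟨hxy, fun hmem => ?_⟩
    have hN := (fp_brSet h k (Nw_sub hw) hmem).1
    rw [map_add] at hN
    rcases fp_DelJPosB h k hxA with h1 | h1
    · rcases fp_DelJPosB h k hyA with h2 | h2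
      · obtain ⟨hS, hSp⟩ := (mem_Nw hw).mp hN
        have aux : ∀ z ∈ DelJPosB α δ θ s J, z ∉ DKJm α δ θ s J ∅ w → fp d δ z ∈ DeloJ α s J →
            PosoComb α (w⁻¹ (fp d δ z)) := by
          intro z hzA hz hzJ
          have hr := DeloJ_sub J (act_mem (inv_mem hw) hzJ)
          by_contra hcon
          exact hz (mem_brSet_of_fp h k (Nw_sub hw) hzA
            ((mem_Nw hw).mpr ⟨hzJ, neg_of_not_pos h hr hcon⟩))
        have := poso_add (aux x hxA hx h1.1) (aux y hyA hy h2.1)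
        rw [← map_add] at this
        exact not_both h (DeloJ_sub J (act_mem (inv_mem hw) hS)) this hSp
      · rw [h2, add_zero] at hN
        exact hx (mem_brSet_of_fp h k (Nw_sub hw) hxA hN)
    · rw [h1, zero_add] at hN
      exact hy (mem_brSet_of_fp h k (Nw_sub hw) hyA hN)
  · intro x hx
    exact (fp_brSet h k (Nw_sub hw) hx).2.2

lemma DKJm_inj (h : AffineSetup α δ θ B s) {J : Set ι} {w w' : V ≃ₗ[ℝ] V}
    (hw : w ∈ WoJ α s J) (hw' : w' ∈ WoJ α s J)
    (hsub : DKJm α δ θ s J ∅ w ⊆ DKJm α δ θ s J ∅ w') : w = w' := by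
  obtain ⟨d, c, k⟩ := exists_coord h
  have h1 : w'⁻¹ * w = 1 := by
    refine eq_one h (mul_mem (inv_mem hw') hw) fun j hj => ?_
    have hmem : w (-α j) ∈ ⇑w '' DeloKJneg α s J ∅ := by
      refine ⟨-α j, ⟨⟨neg_mem h (simple_mem hj), ?_⟩, ?_⟩, rfl⟩
      · rintro ⟨_, _, j, hj, _⟩
        exact hj
      · change PosoComb α (- -α j)
        rw [neg_neg]; exact simple_pos j
    obtain ⟨x, hx⟩ := brkt_nonempty h (Nw_sub hw hmem)
    have hfx : fp d δ x = w (-α j) := by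
      obtain ⟨m, hm⟩ := hx.1
      rw [hm, fp_real h k (Nw_sub hw hmem)]
    have h2 := (fp_brSet h k (Nw_sub hw') (hsub (mem_brSet hmem hx))).1
    rw [hfx] at h2
    have h3 := ((mem_Nw hw').mp h2).2
    rw [map_neg, map_neg, neg_neg] at h3
    exact h3
  exact (inv_mul_eq_one.mp h1).symm

lemma part_one (h : AffineSetup α δ θ B s) {J : Set ι} {Bs : Set V}
    (hB : RealConvexIn α δ θ s (DelJPosB α δ θ s J) Bs) :
    ∃ w ∈ WoJ α s J, Bs ⊆ DKJm α δ θ s J ∅ w := by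
  obtain ⟨d, c, k⟩ := exists_coord h
  obtain ⟨⟨hBA, hBc⟩, hBr⟩ := hB
  have hreal : ∀ x ∈ Bs, fp d δ x ∈ DeloJ α s J ∧ x ∈ brkt α δ θ s (fp d δ x) := by
    intro x hx
    refine (fp_DelJPosB h k (hBA hx)).resolve_right fun h0 => ?_
    exact root_ne_zero h (fp_rePos h k (hBr hx)) h0
  have hsum : ∀ x ∈ Bs, ∀ y ∈ Bs, PosComb α δ θ (x + y) ∧
      ∃ n : ℕ, x + y = (n : ℤ) • δ + fp d δ (x + y) := by
    intro x hx y hy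
    obtain ⟨m, hm⟩ := (hreal x hx).2.1
    obtain ⟨n, hn⟩ := (hreal y hy).2.1
    refine ⟨poscomb_add (hBr hx).2.2 (hBr hy).2.2, m + n, ?_⟩
    rw [map_add]
    conv_lhs => rw [hm, hn]
    push_cast
    rw [add_smul]; abel
  obtain ⟨w, hw, hPw⟩ := exists_w h (J := J) (P := ⇑(fp d δ) '' Bs) (by
      rintro _ ⟨x, hx, rfl⟩
      exact (hreal x hx).1) (by
    refine salient_of h (J := J) ?_ ?_ ?_
    · rintro _ ⟨x, hx, rfl⟩
      exact (hreal x hx).1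
    · rintro _ ⟨x, hx, rfl⟩ _ ⟨y, hy, rfl⟩ h0
      rw [← map_add] at h0
      obtain ⟨-, n, hn⟩ := hsum x hx y hy
      rw [h0, add_zero] at hn
      rcases Nat.eq_zero_or_pos n with rfl | hpos
      · simp only [Nat.cast_zero, zero_smul] at hn
        have hy' : y = -x := eq_neg_of_add_eq_zero_right hn
        have := poscomb_antisymm h (hBr hx).2.2 (hy' ▸ (hBr hy).2.2)
        have h2 := (hreal x hx).1
        rw [this, map_zero] at h2
        exact root_ne_zero h (DeloJ_sub J h2) rfl
      · have hA : x + y ∈ DelJPosB α δ θ s J := Or.inr ⟨n, hpos, hn⟩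
        have h2 := (hreal _ (hBc x hx y hy hA)).1
        rw [h0] at h2
        exact root_ne_zero h (DeloJ_sub J h2) rfl
    · rintro _ ⟨x, hx, rfl⟩ _ ⟨y, hy, rfl⟩ hr
      rw [← map_add] at hr ⊢
      obtain ⟨hp, n, hn⟩ := hsum x hx y hy
      refine ⟨x + y, hBc x hx y hy (Or.inl (mem_brSet hr ?_)), rfl⟩
      have hre : x + y ∈ DelRe α δ s := ⟨n, _, DeloJ_sub J hr, hn⟩
      exact ⟨⟨n, hn⟩, hre, Or.inl hre, hp⟩)
  exact ⟨w, hw, fun x hx => mem_brSet (hPw ⟨x, hx, rfl⟩) (hreal x hx).2⟩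

end AffAux

/-- Proposition 6.3: (1) every real convex set `B` in `Δ_{J+}` is contained in some
`Δ_J(w, −)`, `w ∈ ∘W_J`; (2) `w ↦ Δ_J(w, −)` is a bijection from `∘W_J` onto the set of
all maximal real convex sets in `Δ_{J+}`, and the maximal real convex sets coincide with
the maximal real biconvex sets. -/
theorem statement15 (α : ι → V) (δ θ : V) (B : V →ₗ[ℝ] V →ₗ[ℝ] ℝ) (s : V → V ≃ₗ[ℝ] V)
    (h : AffineSetup α δ θ B s) (J : Set ι) (hJ : J.Nonempty) :
    (∀ Bs : Set V, RealConvexIn α δ θ s (DelJPosB α δ θ s J) Bs →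
      ∃ w ∈ WoJ α s J, Bs ⊆ DKJm α δ θ s J ∅ w) ∧
    Set.BijOn (fun w => DKJm α δ θ s J ∅ w) (WoJ α s J : Set (V ≃ₗ[ℝ] V))
      {M : Set V | RealConvexIn α δ θ s (DelJPosB α δ θ s J) M ∧
        ∀ Bs : Set V, RealConvexIn α δ θ s (DelJPosB α δ θ s J) Bs → M ⊆ Bs → Bs = M} ∧
    {M : Set V | RealConvexIn α δ θ s (DelJPosB α δ θ s J) M ∧
        ∀ Bs : Set V, RealConvexIn α δ θ s (DelJPosB α δ θ s J) Bs → M ⊆ Bs → Bs = M} =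
      {M : Set V | RealBiconvexIn α δ θ s (DelJPosB α δ θ s J) M ∧
        ∀ Bs : Set V, RealBiconvexIn α δ θ s (DelJPosB α δ θ s J) Bs → M ⊆ Bs → Bs = M} := by
  have hmaxc : ∀ w ∈ WoJ α s J, RealConvexIn α δ θ s (DelJPosB α δ θ s J) (DKJm α δ θ s J ∅ w) ∧
      ∀ Bs : Set V, RealConvexIn α δ θ s (DelJPosB α δ θ s J) Bs →
        DKJm α δ θ s J ∅ w ⊆ Bs → Bs = DKJm α δ θ s J ∅ w := by
    intro w hw
    refine ⟨⟨(AffAux.DKJm_biconvex h hw).1.1, (AffAux.DKJm_biconvex h hw).2⟩, ?_⟩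
    intro Bs hBs hsub
    obtain ⟨w', hw', hB'⟩ := AffAux.part_one h hBs
    have := AffAux.DKJm_inj h hw hw' (hsub.trans hB')
    subst this
    exact Set.Subset.antisymm hB' hsub
  have hsurj : ∀ M : Set V, RealConvexIn α δ θ s (DelJPosB α δ θ s J) M →
      (∀ w ∈ WoJ α s J, M ⊆ DKJm α δ θ s J ∅ w → DKJm α δ θ s J ∅ w = M) →
      ∃ w ∈ WoJ α s J, DKJm α δ θ s J ∅ w = M := by
    intro M hM hmax
    obtain ⟨w, hw, hsub⟩ := AffAux.part_one h hM
    exact ⟨w, hw, hmax w hw hsub⟩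
  refine ⟨fun Bs hBs => AffAux.part_one h hBs, ⟨fun w hw => hmaxc w hw, ?_, ?_⟩, ?_⟩
  · intro w hw w' hw' heq
    exact AffAux.DKJm_inj h hw hw' (le_of_eq heq)
  · rintro M ⟨hM, hmax⟩
    exact hsurj M hM fun w hw hsub => hmax _ (hmaxc w hw).1 hsub
  · ext M
    constructor
    · rintro ⟨hM, hmax⟩
      obtain ⟨w, hw, rfl⟩ := hsurj M hM fun w hw hsub => hmax _ (hmaxc w hw).1 hsub
      refine ⟨AffAux.DKJm_biconvex h hw, fun Bs hBs hsub => hmax Bs ⟨hBs.1.1, hBs.2⟩ hsub⟩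
    · rintro ⟨hM, hmax⟩
      obtain ⟨w, hw, rfl⟩ := hsurj M ⟨hM.1.1, hM.2⟩
        fun w hw hsub => hmax _ (AffAux.DKJm_biconvex h hw) hsub
      exact hmaxc w hw


end
end
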